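/- arXiv:math/0401069 — 2 statements merged into one kernel-verified Lean document; each statement's English description precedes it below -/
import Mathlib

section
/- There is a constant b₀ > 0 such that for every λ > 0 and every finite connected transitive graph 𝔾 satisfying the triangle condition ∇_{p_c}(x,y) ≤ δ_{x,y} + a₀ with a₀ ≤ b₀ and λV^{1/3} ≥ b₀^{-1}, the following holds: for every p ≤ p_c and every 0 ≤ γ ≤ 1, the magnetization satisfies (1/3)·min{√γ, γχ(p)} ≤ M(p,γ) ≤ min{√(12γ), γχ(p)}. -/
noncomputable section
open Classical

namespace Percolation

variable {V : Type*} [Fintype V] [DecidableEq V]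

/-- A percolation configuration: an assignment of occupied (`true`) or
vacant (`false`) to each bond of the graph. -/
def Config (G : SimpleGraph V) : Type _ := G.edgeSet → Bool

noncomputable instance (G : SimpleGraph V) : Fintype G.edgeSet :=
  Fintype.ofFinite _

noncomputable instance (G : SimpleGraph V) : Fintype (Config G) :=
  inferInstanceAs (Fintype (G.edgeSet → Bool))

/-- The probability weight of a configuration under the product Bernoulli
measure with parameter `p`. -/
def weight (G : SimpleGraph V) (p : ℝ) (ω : Config G) : ℝ :=
  ∏ e : G.edgeSet, if ω e then p else 1 - p

/-- The probability of an event under the percolation measure `ℙ_p`. -/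
def prob (G : SimpleGraph V) (p : ℝ) (A : Config G → Prop) : ℝ :=
  ∑ ω : Config G, if A ω then weight G p ω else 0

/-- The expectation of a random variable under the percolation measure `ℙ_p`. -/
def expect (G : SimpleGraph V) (p : ℝ) (f : Config G → ℝ) : ℝ :=
  ∑ ω : Config G, weight G p ω * f ω

/-- The subgraph consisting of the occupied bonds of a configuration. -/
def occupied (G : SimpleGraph V) (ω : Config G) : SimpleGraph V :=
  SimpleGraph.fromEdgeSet {e | ∃ h : e ∈ G.edgeSet, ω ⟨e, h⟩ = true}

/-- The cluster `C(x)` of the vertex `x`: all vertices joined to `x` by a path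
of occupied bonds (including `x` itself). -/
def cluster (G : SimpleGraph V) (ω : Config G) (x : V) : Finset V :=
  Finset.univ.filter fun y => (occupied G ω).Reachable x y

/-- The susceptibility `χ(p)`: the expected size of the cluster of `x₀`. -/
def chi (G : SimpleGraph V) (x₀ : V) (p : ℝ) : ℝ :=
  expect G p fun ω => ((cluster G ω x₀).card : ℝ)

/-- The two-point function `τ_p(x,y) = ℙ_p(x ↔ y)`. -/
def tau (G : SimpleGraph V) (p : ℝ) (x y : V) : ℝ :=
  prob G p fun ω => (occupied G ω).Reachable x y

/-- The triangle diagram `∇_p(x,y)`. -/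
def triangle (G : SimpleGraph V) (p : ℝ) (x y : V) : ℝ :=
  ∑ u : V, ∑ v : V, tau G p x u * tau G p u v * tau G p v y

/-- The Kronecker delta `δ_{x,y}`. -/
def kron (x y : V) : ℝ := if x = y then 1 else 0

/-- `∇̄_p`: the maximum of the triangle diagram over bonds `{x,y} ∈ 𝔹`. -/
def nablaBar (G : SimpleGraph V) (p : ℝ) : ℝ :=
  sSup {t : ℝ | ∃ x y : V, G.Adj x y ∧ t = triangle G p x y}

/-- A graph is (vertex-)transitive if any vertex can be mapped to any other
by a graph automorphism. -/
def IsTransitive (G : SimpleGraph V) : Prop :=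
  ∀ x y : V, ∃ φ : G ≃g G, φ x = y

/-- The size `|C_max|` of the largest cluster. -/
def maxCluster (G : SimpleGraph V) (ω : Config G) : ℕ :=
  Finset.univ.sup fun x => (cluster G ω x).card

/-- The cluster size distribution `P_{≥k}(p) = ℙ_p(|C(x₀)| ≥ k)`. -/
def Pgeq (G : SimpleGraph V) (x₀ : V) (p : ℝ) (k : ℝ) : ℝ :=
  prob G p fun ω => k ≤ ((cluster G ω x₀).card : ℝ)

/-- The magnetization `M(p,γ)`. -/
def magnetization (G : SimpleGraph V) (x₀ : V) (p γ : ℝ) : ℝ :=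
  ∑ k ∈ Finset.Icc 1 (Fintype.card V),
    (1 - (1 - γ) ^ k) * prob G p fun ω => (cluster G ω x₀).card = k

/-- `Z_{≥s}`: the number of vertices lying in clusters of size at least `s`. -/
def Zgeq (G : SimpleGraph V) (s : ℝ) (ω : Config G) : ℝ :=
  ∑ x : V, if s ≤ ((cluster G ω x).card : ℝ) then (1 : ℝ) else 0

/-- The variance of a random variable under `ℙ_p`. -/
def variance (G : SimpleGraph V) (p : ℝ) (f : Config G → ℝ) : ℝ :=
  expect G p (fun ω => f ω ^ 2) - (expect G p f) ^ 2

/-- The restricted susceptibility `χ_{≥s}(p) = 𝔼_p[|C(x₀)| I[|C(x₀)| ≥ s]]`. -/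
def chiGeq (G : SimpleGraph V) (x₀ : V) (p : ℝ) (s : ℝ) : ℝ :=
  expect G p fun ω =>
    if s ≤ ((cluster G ω x₀).card : ℝ) then ((cluster G ω x₀).card : ℝ) else 0

/-- The restricted susceptibility `χ_{<s}(p) = 𝔼_p[|C(x₀)| I[|C(x₀)| < s]]`. -/
def chiLt (G : SimpleGraph V) (x₀ : V) (p : ℝ) (s : ℝ) : ℝ :=
  expect G p fun ω =>
    if ((cluster G ω x₀).card : ℝ) < s then ((cluster G ω x₀).card : ℝ) else 0

end Percolation

namespace PercAux
set_option linter.unusedSectionVars false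

section ExSec
variable {α : Type*} [DecidableEq α]

/-- Expectation over a random subset of `E`, each element kept with probability `p`. -/
def Ex (p : ℝ) (E : Finset α) (f : Finset α → ℝ) : ℝ :=
  ∑ F ∈ E.powerset, p ^ F.card * (1 - p) ^ (E \ F).card * f F

lemma Ex_empty (p : ℝ) (f : Finset α → ℝ) : Ex p ∅ f = f ∅ := by
  simp [Ex]

lemma Ex_insert (p : ℝ) {E : Finset α} {e : α} (he : e ∉ E) (f : Finset α → ℝ) :
    Ex p (insert e E) f = (1 - p) * Ex p E f + p * Ex p E (fun F => f (insert e F)) := by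
  unfold Ex
  rw [Finset.sum_powerset_insert he, Finset.mul_sum, Finset.mul_sum]
  congr 1
  · apply Finset.sum_congr rfl
    intro F hF
    have hF' := Finset.mem_powerset.1 hF
    have h1 : e ∉ F := fun h => he (hF' h)
    have h2 : (insert e E \ F).card = (E \ F).card + 1 := by
      rw [Finset.insert_sdiff_of_notMem _ h1, Finset.card_insert_of_notMem]
      simp [he]
    rw [h2, pow_succ]; ring
  · apply Finset.sum_congr rfl
    intro F hF
    have hF' := Finset.mem_powerset.1 hF
    have h1 : e ∉ F := fun h => he (hF' h)
    have h2 : (insert e E \ insert e F) = (E \ F) := by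
      ext a; simp only [Finset.mem_sdiff, Finset.mem_insert]
      constructor
      · rintro ⟨h | h, h'⟩
        · exact absurd (Or.inl h) h'
        · exact ⟨h, fun h'' => h' (Or.inr h'')⟩
      · rintro ⟨h, h'⟩
        refine ⟨Or.inr h, ?_⟩
        rintro (h'' | h'')
        · exact he (h'' ▸ h)
        · exact h' h''
    rw [h2, Finset.card_insert_of_notMem h1, pow_succ]; ring

lemma Ex_add (p : ℝ) (E : Finset α) (f g : Finset α → ℝ) :
    Ex p E (fun F => f F + g F) = Ex p E f + Ex p E g := by
  unfold Ex; rw [← Finset.sum_add_distrib]; apply Finset.sum_congr rfl; intros; ring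

lemma Ex_sub (p : ℝ) (E : Finset α) (f g : Finset α → ℝ) :
    Ex p E (fun F => f F - g F) = Ex p E f - Ex p E g := by
  unfold Ex; rw [← Finset.sum_sub_distrib]; apply Finset.sum_congr rfl; intros; ring

lemma Ex_mul_left (p : ℝ) (E : Finset α) (c : ℝ) (f : Finset α → ℝ) :
    Ex p E (fun F => c * f F) = c * Ex p E f := by
  unfold Ex; rw [Finset.mul_sum]; apply Finset.sum_congr rfl; intros; ring

lemma Ex_mul_right (p : ℝ) (E : Finset α) (c : ℝ) (f : Finset α → ℝ) :
    Ex p E (fun F => f F * c) = Ex p E f * c := by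
  unfold Ex; rw [Finset.sum_mul]; apply Finset.sum_congr rfl; intros; ring

lemma Ex_sum {ι : Type*} (p : ℝ) (E : Finset α) (s : Finset ι) (f : ι → Finset α → ℝ) :
    Ex p E (fun F => ∑ i ∈ s, f i F) = ∑ i ∈ s, Ex p E (f i) := by
  unfold Ex; rw [Finset.sum_comm]; apply Finset.sum_congr rfl; intros
  rw [Finset.mul_sum]

lemma Ex_congr (p : ℝ) (E : Finset α) {f g : Finset α → ℝ} (h : ∀ F, F ⊆ E → f F = g F) :
    Ex p E f = Ex p E g := by
  unfold Ex; apply Finset.sum_congr rfl; intro F hF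
  rw [h F (Finset.mem_powerset.1 hF)]

lemma Ex_const (p : ℝ) (E : Finset α) (c : ℝ) : Ex p E (fun _ => c) = c := by
  induction E using Finset.induction_on with
  | empty => simp [Ex_empty]
  | insert e E he ih => rw [Ex_insert p he, ih]; ring

lemma Ex_mono {p : ℝ} (hp0 : 0 ≤ p) (hp1 : p ≤ 1) (E : Finset α) {f g : Finset α → ℝ}
    (h : ∀ F, F ⊆ E → f F ≤ g F) : Ex p E f ≤ Ex p E g := by
  unfold Ex; apply Finset.sum_le_sum; intro F hF
  have : 0 ≤ 1 - p := by linarith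
  exact mul_le_mul_of_nonneg_left (h F (Finset.mem_powerset.1 hF)) (by positivity)

lemma Ex_nonneg {p : ℝ} (hp0 : 0 ≤ p) (hp1 : p ≤ 1) (E : Finset α) {f : Finset α → ℝ}
    (h : ∀ F, F ⊆ E → 0 ≤ f F) : 0 ≤ Ex p E f := by
  have := Ex_mono hp0 hp1 E (f := fun _ => 0) h
  rwa [Ex_const] at this

lemma Ex_mono_set {p : ℝ} (hp0 : 0 ≤ p) (hp1 : p ≤ 1) {E' E : Finset α} (hE : E' ⊆ E)
    {f : Finset α → ℝ} (h : ∀ F F', F ⊆ F' → f F ≤ f F') : Ex p E' f ≤ Ex p E f := by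
  induction E using Finset.induction_on generalizing E' f with
  | empty => rw [Finset.subset_empty.1 hE]
  | insert e E he ih =>
    rw [Ex_insert p he]
    have hm : Ex p E f ≤ Ex p E (fun F => f (insert e F)) :=
      Ex_mono hp0 hp1 E fun F _ => h _ _ (Finset.subset_insert _ _)
    by_cases he' : e ∈ E'
    · have e1 : E' = insert e (E'.erase e) := (Finset.insert_erase he').symm
      have hs : E'.erase e ⊆ E := by
        intro a ha
        have := hE (Finset.mem_of_mem_erase ha)
        rcases Finset.mem_insert.1 this with h | h
        · exact absurd h (Finset.ne_of_mem_erase ha)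
        · exact h
      rw [e1, Ex_insert p (Finset.notMem_erase _ _)]
      have h1 := ih hs h
      have h2 := ih hs (f := fun F => f (insert e F))
        (fun F F' hF => h _ _ (Finset.insert_subset_insert _ hF))
      have := mul_le_mul_of_nonneg_left h1 (by linarith : 0 ≤ 1 - p)
      have := mul_le_mul_of_nonneg_left h2 hp0
      linarith
    · have hs : E' ⊆ E := by
        intro a ha
        rcases Finset.mem_insert.1 (hE ha) with h | h
        · exact absurd (h ▸ ha) he'
        · exact h
      have h1 := ih hs h
      nlinarith

lemma Ex_mono_p {p p' : ℝ} (hp0 : 0 ≤ p) (hpp : p ≤ p') (hp1 : p' ≤ 1) {E : Finset α}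
    {f : Finset α → ℝ} (h : ∀ F F', F ⊆ F' → f F ≤ f F') : Ex p E f ≤ Ex p' E f := by
  induction E using Finset.induction_on generalizing f with
  | empty => simp [Ex_empty]
  | insert e E he ih =>
    rw [Ex_insert p he, Ex_insert p' he]
    have hm : Ex p E f ≤ Ex p E (fun F => f (insert e F)) :=
      Ex_mono hp0 (hpp.trans hp1) E fun F _ => h _ _ (Finset.subset_insert _ _)
    have h1 := ih h
    have h2 := ih (f := fun F => f (insert e F))
        (fun F F' hF => h _ _ (Finset.insert_subset_insert _ hF))
    nlinarith

lemma Ex_indep (p : ℝ) (E : Finset α) (P : α → Prop) [DecidablePred P] {g h : Finset α → ℝ}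
    (hg : ∀ F, g F = g (F.filter P)) (hh : ∀ F, h F = h (F.filter fun a => ¬ P a)) :
    Ex p E (fun F => g F * h F) = Ex p E g * Ex p E h := by
  induction E using Finset.induction_on generalizing g h with
  | empty => simp [Ex_empty]
  | insert e E he ih =>
    rw [Ex_insert p he, Ex_insert p he, Ex_insert p he, ih hg hh]
    by_cases hP : P e
    · have h1 : ∀ F, h (insert e F) = h F := by
        intro F; rw [hh, hh F, Finset.filter_insert, if_neg (by simpa using hP)]
      have h2 := ih (g := fun F => g (insert e F)) (h := h) (by
        intro F
        show g (insert e F) = g (insert e (F.filter P))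
        rw [hg, hg (insert e (F.filter P))]
        simp [Finset.filter_insert, hP, Finset.filter_filter]) hh
      simp only [h1]
      rw [h2]; ring
    · have h1 : ∀ F, g (insert e F) = g F := by
        intro F; rw [hg, hg F, Finset.filter_insert, if_neg hP]
      have h2 := ih (g := g) (h := fun F => h (insert e F)) hg (by
        intro F
        show h (insert e F) = h (insert e (F.filter fun a => ¬ P a))
        rw [hh, hh (insert e (F.filter fun a => ¬ P a))]
        simp [Finset.filter_insert, hP, Finset.filter_filter])
      simp only [h1]
      rw [h2]; ring

lemma Ex_mem_erase (p : ℝ) {E : Finset α} {e : α} (he : e ∈ E) (g : Finset α → ℝ) :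
    Ex p E (fun F => if e ∈ F then g (F.erase e) else 0) = p * Ex p (E.erase e) g := by
  conv_lhs => rw [← Finset.insert_erase he]
  rw [Ex_insert p (Finset.notMem_erase _ _)]
  have h1 : Ex p (E.erase e) (fun F => if e ∈ F then g (F.erase e) else 0) = 0 := by
    rw [Ex_congr p _ (g := fun _ => 0), Ex_const]
    intro F hF
    rw [if_neg (fun h => Finset.notMem_erase e E (hF h))]
  have h2 : Ex p (E.erase e) (fun F => if e ∈ insert e F then g ((insert e F).erase e) else 0)
      = Ex p (E.erase e) g := by
    apply Ex_congr
    intro F hF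
    rw [if_pos (Finset.mem_insert_self _ _), Finset.erase_insert]
    exact fun h => Finset.notMem_erase e E (hF h)
  rw [h1, h2]; ring

lemma Ex_image (p : ℝ) (E : Finset α) (σ : α → α) (hσ : Function.Injective σ)
    (f : Finset α → ℝ) : Ex p (E.image σ) f = Ex p E (fun F => f (F.image σ)) := by
  induction E using Finset.induction_on generalizing f with
  | empty => simp [Ex_empty]
  | insert e E he ih =>
    rw [Finset.image_insert, Ex_insert p he, Ex_insert p, ih, ih]
    · simp only [Finset.image_insert]
    · intro h
      obtain ⟨a, ha, hae⟩ := Finset.mem_image.1 h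
      exact he (hσ hae ▸ ha)

lemma Ex_void (γ : ℝ) (W S : Finset α) :
    Ex γ W (fun Γ => if Disjoint Γ S then 1 else 0) = (1 - γ) ^ (S ∩ W).card := by
  induction W using Finset.induction_on with
  | empty => simp [Ex_empty]
  | insert e W he ih =>
    rw [Ex_insert γ he, ih]
    by_cases hS : e ∈ S
    · have : Ex γ W (fun F => if Disjoint (insert e F) S then (1:ℝ) else 0) = 0 := by
        rw [Ex_congr γ _ (g := fun _ => 0), Ex_const]
        intro F hF
        rw [if_neg]; simp [hS]
      rw [this, Finset.inter_insert_of_mem hS, Finset.card_insert_of_notMem (by simp [he])]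
      rw [pow_succ]; ring
    · have : Ex γ W (fun F => if Disjoint (insert e F) S then (1:ℝ) else 0)
          = (1 - γ) ^ (S ∩ W).card := by
        rw [← ih]; congr 1; ext F; simp [hS]
      rw [this, Finset.inter_insert_of_notMem hS]; ring

lemma Ex_continuous (E : Finset α) (f : Finset α → ℝ) : Continuous fun p => Ex p E f := by
  unfold Ex; fun_prop

end ExSec

section ClSec
variable {V : Type*} [Fintype V] [DecidableEq V]

/-- Vertices reachable from `S` using the edges in `F`. -/
def cl (F : Finset (Sym2 V)) (S : Finset V) : Finset V :=
  Finset.univ.filter fun x => ∃ s ∈ S, Relation.ReflTransGen (fun a b => s(a, b) ∈ F) s x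

/-- The edges of `F` not touching `U`. -/
def off (F : Finset (Sym2 V)) (U : Finset V) : Finset (Sym2 V) :=
  F.filter fun e => ¬ ∃ a ∈ U, a ∈ e

/-- The edges of `F` touching `U`. -/
def tch (F : Finset (Sym2 V)) (U : Finset V) : Finset (Sym2 V) :=
  F.filter fun e => ∃ a ∈ U, a ∈ e

lemma mem_off {F : Finset (Sym2 V)} {U : Finset V} {a b : V} :
    s(a, b) ∈ off F U ↔ s(a, b) ∈ F ∧ a ∉ U ∧ b ∉ U := by
  simp only [off, Finset.mem_filter, Sym2.mem_iff]
  constructor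
  · rintro ⟨h, h'⟩
    exact ⟨h, fun ha => h' ⟨a, ha, Or.inl rfl⟩, fun hb => h' ⟨b, hb, Or.inr rfl⟩⟩
  · rintro ⟨h, ha, hb⟩
    refine ⟨h, ?_⟩
    rintro ⟨c, hc, rfl | rfl⟩
    · exact ha hc
    · exact hb hc

lemma mem_tch {F : Finset (Sym2 V)} {U : Finset V} {a b : V} :
    s(a, b) ∈ tch F U ↔ s(a, b) ∈ F ∧ (a ∈ U ∨ b ∈ U) := by
  simp only [tch, Finset.mem_filter, Sym2.mem_iff]
  constructor
  · rintro ⟨h, c, hc, rfl | rfl⟩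
    · exact ⟨h, Or.inl hc⟩
    · exact ⟨h, Or.inr hc⟩
  · rintro ⟨h, ha | hb⟩
    · exact ⟨h, a, ha, Or.inl rfl⟩
    · exact ⟨h, b, hb, Or.inr rfl⟩

lemma off_subset (F : Finset (Sym2 V)) (U : Finset V) : off F U ⊆ F := Finset.filter_subset _ _
lemma tch_subset (F : Finset (Sym2 V)) (U : Finset V) : tch F U ⊆ F := Finset.filter_subset _ _
lemma off_mono {F F' : Finset (Sym2 V)} (h : F ⊆ F') (U : Finset V) : off F U ⊆ off F' U :=
  Finset.filter_subset_filter _ h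

lemma subset_cl (F : Finset (Sym2 V)) (S : Finset V) : S ⊆ cl F S := fun s hs => by
  simp only [cl, Finset.mem_filter, Finset.mem_univ, true_and]
  exact ⟨s, hs, Relation.ReflTransGen.refl⟩

lemma self_mem_cl (F : Finset (Sym2 V)) (v : V) : v ∈ cl F {v} :=
  subset_cl F {v} (Finset.mem_singleton_self v)

lemma cl_step {F : Finset (Sym2 V)} {S : Finset V} {a b : V} (ha : a ∈ cl F S)
    (hab : s(a, b) ∈ F) : b ∈ cl F S := by
  simp only [cl, Finset.mem_filter, Finset.mem_univ, true_and] at ha ⊢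
  obtain ⟨s, hs, h⟩ := ha
  exact ⟨s, hs, h.tail hab⟩

lemma cl_min {F : Finset (Sym2 V)} {S T : Finset V} (hS : S ⊆ T)
    (hT : ∀ a b, a ∈ T → s(a, b) ∈ F → b ∈ T) : cl F S ⊆ T := by
  intro x hx
  simp only [cl, Finset.mem_filter, Finset.mem_univ, true_and] at hx
  obtain ⟨s, hs, h⟩ := hx
  induction h with
  | refl => exact hS hs
  | tail _ hab ih => exact hT _ _ ih hab

lemma cl_mono {F F' : Finset (Sym2 V)} {S S' : Finset V} (hF : F ⊆ F') (hS : S ⊆ S') :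
    cl F S ⊆ cl F' S' :=
  cl_min (hS.trans (subset_cl _ _)) fun _ _ ha hab => cl_step ha (hF hab)

lemma cl_symm {F : Finset (Sym2 V)} {x y : V} (h : x ∈ cl F {y}) : y ∈ cl F {x} := by
  simp only [cl, Finset.mem_filter, Finset.mem_univ, true_and, Finset.mem_singleton,
    exists_eq_left] at h ⊢
  have : Std.Symm (fun a b : V => s(a, b) ∈ F) := ⟨fun a b h => by rwa [Sym2.eq_swap]⟩
  exact Std.Symm.symm _ _ h

lemma cl_trans {F : Finset (Sym2 V)} {S : Finset V} {x y : V} (hy : y ∈ cl F S)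
    (hx : x ∈ cl F {y}) : x ∈ cl F S :=
  (cl_min (T := cl F S) (by simpa using hy) fun _ _ ha hab => cl_step ha hab) hx

lemma cl_eq_of_mem {F : Finset (Sym2 V)} {x y : V} (h : x ∈ cl F {y}) : cl F {x} = cl F {y} := by
  ext z
  exact ⟨fun hz => cl_trans h hz, fun hz => cl_trans (cl_symm h) hz⟩

lemma cl_union (F : Finset (Sym2 V)) (S T : Finset V) : cl F (S ∪ T) = cl F S ∪ cl F T := by
  apply Finset.Subset.antisymm
  · apply cl_min (Finset.union_subset_union (subset_cl _ _) (subset_cl _ _))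
    intro a b ha hab
    rcases Finset.mem_union.1 ha with h | h
    · exact Finset.mem_union_left _ (cl_step h hab)
    · exact Finset.mem_union_right _ (cl_step h hab)
  · exact Finset.union_subset (cl_mono (Finset.Subset.refl _) Finset.subset_union_left)
      (cl_mono (Finset.Subset.refl _) Finset.subset_union_right)

lemma cl_insert_edge (F : Finset (Sym2 V)) (S : Finset V) {s y : V} (hs : s ∈ S) :
    cl (insert s(s, y) F) S = cl F (insert y S) := by
  apply Finset.Subset.antisymm
  · apply cl_min ((Finset.subset_insert _ _).trans (subset_cl _ _))
    intro a b ha hab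
    rcases Finset.mem_insert.1 hab with h | h
    · rcases Sym2.eq_iff.1 h with ⟨rfl, rfl⟩ | ⟨rfl, rfl⟩
      · exact subset_cl _ _ (Finset.mem_insert_self _ _)
      · exact subset_cl _ _ (Finset.mem_insert_of_mem hs)
    · exact cl_step ha h
  · apply cl_min
    · intro a ha
      rcases Finset.mem_insert.1 ha with rfl | h
      · exact cl_step (subset_cl _ _ hs) (Finset.mem_insert_self _ _)
      · exact subset_cl _ _ h
    · intro a b ha hab
      exact cl_step ha (Finset.mem_insert_of_mem hab)

/-- exploring from `T ⊆ S` only sees edges touching the cluster of `S` -/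
lemma cl_tch {F : Finset (Sym2 V)} {S T : Finset V} (hT : T ⊆ S) :
    cl (tch F (cl F S)) T = cl F T := by
  apply Finset.Subset.antisymm
  · exact cl_mono (tch_subset _ _) (Finset.Subset.refl _)
  · apply cl_min (subset_cl _ _)
    intro a b ha hab
    have : a ∈ cl F S := cl_mono (tch_subset _ _) hT ha
    exact cl_step ha (mem_tch.2 ⟨hab, Or.inl this⟩)

lemma cl_of_tch {F : Finset (Sym2 V)} {S U : Finset V} (h : cl (tch F U) S = U) :
    cl F S = U := by
  apply Finset.Subset.antisymm
  · apply cl_min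
    · rw [← h]; exact subset_cl _ _
    · intro a b ha hab
      rw [← h] at ha ⊢
      have : a ∈ U := by rw [← h]; exact ha
      exact cl_step ha (mem_tch.2 ⟨hab, Or.inl this⟩)
  · rw [← h]
    have := cl_mono (tch_subset F (cl (tch F U) S)) (Finset.Subset.refl S)
    rw [h] at this ⊢; rw [← h]
    rw [h]
    calc U = cl (tch F U) S := h.symm
      _ ⊆ cl F S := cl_mono (tch_subset _ _) (Finset.Subset.refl _)

lemma cl_off {F : Finset (Sym2 V)} {S : Finset V} {z : V} (hz : z ∉ cl F S) :
    cl (off F (cl F S)) {z} = cl F {z} := by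
  apply Finset.Subset.antisymm
  · exact cl_mono (off_subset _ _) (Finset.Subset.refl _)
  · have key : cl F {z} ⊆ (cl (off F (cl F S)) {z}).filter (fun a => a ∉ cl F S) := by
      apply cl_min
      · intro a ha
        rw [Finset.mem_singleton.1 ha]
        exact Finset.mem_filter.2 ⟨self_mem_cl _ _, hz⟩
      · intro a b ha hab
        obtain ⟨h1, h2⟩ := Finset.mem_filter.1 ha
        have hb : b ∉ cl F S := fun hb => h2 (cl_step hb (by rwa [Sym2.eq_swap]))
        exact Finset.mem_filter.2 ⟨cl_step h1 (mem_off.2 ⟨hab, h2, hb⟩), hb⟩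
    exact key.trans (Finset.filter_subset _ _)

lemma off_off (F : Finset (Sym2 V)) (U : Finset V) : off (off F U) U = off F U := by
  simp [off, Finset.filter_filter]

lemma off_tch_comm (F : Finset (Sym2 V)) (U A : Finset V) :
    off (tch F U) A = tch (off F A) U := by
  simp only [off, tch]; exact Finset.filter_comm _ _ _

/-- Domain Markov property. -/
lemma Ex_markov (p : ℝ) (E : Finset (Sym2 V)) (st : Finset (Sym2 V) → Finset V)
    (g : Finset (Sym2 V) → ℝ) (h : Finset V → Finset (Sym2 V) → ℝ)
    (h1 : ∀ F, st (tch F (st F)) = st F ∧ g (tch F (st F)) = g F)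
    (h2 : ∀ F U, st (tch F U) = U → st F = U)
    (hh : ∀ U F, h U F = h U (off F U)) :
    Ex p E (fun F => g F * h (st F) F) = Ex p E (fun F => g F * Ex p E (h (st F))) := by
  have e1 : ∀ F, g F * h (st F) F = ∑ U : Finset V, (if st F = U then g F else 0) * h U F := by
    intro F; simp
  have e2 : ∀ F, g F * Ex p E (h (st F)) =
      ∑ U : Finset V, (if st F = U then g F else 0) * Ex p E (h U) := by
    intro F; simp
  simp only [e1, e2]
  rw [Ex_sum, Ex_sum]
  apply Finset.sum_congr rfl
  intro U _
  rw [Ex_mul_right]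
  apply Ex_indep p E (fun e => ∃ a ∈ U, a ∈ e)
  · intro F
    change (if st F = U then g F else 0) = (if st (tch F U) = U then g (tch F U) else 0)
    by_cases hU : st F = U
    · subst hU
      rw [(h1 F).1, (h1 F).2]
    · rw [if_neg hU, if_neg (fun h' => hU (h2 F U h'))]
  · exact hh U

lemma cl_closed_eq {F : Finset (Sym2 V)} {S : Finset V}
    (h : ∀ a b, a ∈ S → s(a, b) ∈ F → b ∈ S) : cl F S = S :=
  Finset.Subset.antisymm (cl_min (Finset.Subset.refl _) h) (subset_cl _ _)

/-- Covariance (tree-graph) inequality. -/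
lemma Ex_cov {p : ℝ} (hp0 : 0 ≤ p) (hp1 : p ≤ 1) (φ ψ : Finset V → ℝ)
    (hφm : ∀ C D, C ⊆ D → φ C ≤ φ D) (hφs : ∀ C D, φ (C ∪ D) ≤ φ C + φ D)
    (hψm : ∀ C D, C ⊆ D → ψ C ≤ ψ D) (hψs : ∀ C D, ψ (C ∪ D) ≤ ψ C + ψ D)
    (P Q : V → ℝ) (E : Finset (Sym2 V))
    (hP : ∀ E' ⊆ E, ∀ u, Ex p E' (fun F => φ (cl F {u})) ≤ P u)
    (hQ : ∀ E' ⊆ E, ∀ u, Ex p E' (fun F => ψ (cl F {u})) ≤ Q u) (S : Finset V) :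
    Ex p E (fun F => φ (cl F S) * ψ (cl F S)) ≤
      Ex p E (fun F => φ (cl F S)) * Ex p E (fun F => ψ (cl F S)) +
      ∑ u ∈ Finset.univ \ S, Ex p E (fun F => if u ∈ cl F S then 1 else 0) * (P u * Q u) := by
  induction hn : E.card using Nat.strong_induction_on generalizing E S with
  | _ n ih =>
  subst hn
  by_cases hex : ∃ s y, s ∈ S ∧ y ∉ S ∧ s(s, y) ∈ E
  · obtain ⟨s, y, hs, hy, he⟩ := hex
    have hne : s(s, y) ∉ E.erase s(s, y) := Finset.notMem_erase _ _
    have hsub : E.erase s(s, y) ⊆ E := Finset.erase_subset _ _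
    set E' := E.erase s(s, y) with hE'
    have hEE : E = insert s(s, y) E' := (Finset.insert_erase he).symm
    have hcard : E'.card < E.card := Finset.card_erase_lt_of_mem he
    have ih1 := ih _ hcard E' (fun E'' h => hP E'' (h.trans hsub))
      (fun E'' h => hQ E'' (h.trans hsub)) S rfl
    have ih2 := ih _ hcard E' (fun E'' h => hP E'' (h.trans hsub))
      (fun E'' h => hQ E'' (h.trans hsub)) (insert y S) rfl
    have hPy := hP E' hsub y
    have hQy := hQ E' hsub y
    rw [hEE]
    simp only [Ex_insert p hne, cl_insert_edge _ _ hs]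
    have hcl : ∀ F : Finset (Sym2 V), cl F (insert y S) = cl F S ∪ cl F {y} := by
      intro F; rw [← cl_union, Finset.union_comm]; rfl
    have hda : Ex p E' (fun F => φ (cl F (insert y S))) ≤ Ex p E' (fun F => φ (cl F S)) + P y := by
      refine le_trans ?_ (add_le_add_right hPy _)
      rw [← Ex_add]
      exact Ex_mono hp0 hp1 _ fun F _ => by rw [hcl]; exact hφs _ _
    have hdb : Ex p E' (fun F => ψ (cl F (insert y S))) ≤ Ex p E' (fun F => ψ (cl F S)) + Q y := by
      refine le_trans ?_ (add_le_add_right hQy _)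
      rw [← Ex_add]
      exact Ex_mono hp0 hp1 _ fun F _ => by rw [hcl]; exact hψs _ _
    have hma : Ex p E' (fun F => φ (cl F S)) ≤ Ex p E' (fun F => φ (cl F (insert y S))) :=
      Ex_mono hp0 hp1 _ fun F _ => hφm _ _ (cl_mono (Finset.Subset.refl _) (Finset.subset_insert _ _))
    have hmb : Ex p E' (fun F => ψ (cl F S)) ≤ Ex p E' (fun F => ψ (cl F (insert y S))) :=
      Ex_mono hp0 hp1 _ fun F _ => hψm _ _ (cl_mono (Finset.Subset.refl _) (Finset.subset_insert _ _))
    set a := Ex p E' (fun F => φ (cl F (insert y S)))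
    set a' := Ex p E' (fun F => φ (cl F S))
    set b := Ex p E' (fun F => ψ (cl F (insert y S)))
    set b' := Ex p E' (fun F => ψ (cl F S))
    have hsd : Finset.univ \ S = insert y (Finset.univ \ insert y S) := by
      ext u; simp only [Finset.mem_sdiff, Finset.mem_univ, true_and, Finset.mem_insert]
      by_cases hu : u = y
      · subst hu; simp [hy]
      · simp [hu]
    have hsum : ∑ u ∈ Finset.univ \ S,
        ((1 - p) * Ex p E' (fun F => if u ∈ cl F S then (1:ℝ) else 0) +
          p * Ex p E' (fun F => if u ∈ cl F (insert y S) then (1:ℝ) else 0)) * (P u * Q u) =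
        (1 - p) * ∑ u ∈ Finset.univ \ S, Ex p E' (fun F => if u ∈ cl F S then (1:ℝ) else 0) * (P u * Q u)
        + p * ∑ u ∈ Finset.univ \ insert y S,
            Ex p E' (fun F => if u ∈ cl F (insert y S) then (1:ℝ) else 0) * (P u * Q u)
        + p * (P y * Q y) := by
      have h1 : Ex p E' (fun F => if y ∈ cl F (insert y S) then (1:ℝ) else 0) = 1 := by
        have : ∀ F : Finset (Sym2 V), y ∈ cl F (insert y S) :=
          fun F => subset_cl _ _ (Finset.mem_insert_self _ _)
        simp only [this, if_true, Ex_const]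
      have h2 : ∑ u ∈ Finset.univ \ S,
          Ex p E' (fun F => if u ∈ cl F (insert y S) then (1:ℝ) else 0) * (P u * Q u) =
          P y * Q y + ∑ u ∈ Finset.univ \ insert y S,
            Ex p E' (fun F => if u ∈ cl F (insert y S) then (1:ℝ) else 0) * (P u * Q u) := by
        rw [hsd, Finset.sum_insert (by simp), h1, one_mul]
      have h3 : ∀ u, ((1 - p) * Ex p E' (fun F => if u ∈ cl F S then (1:ℝ) else 0) +
          p * Ex p E' (fun F => if u ∈ cl F (insert y S) then (1:ℝ) else 0)) * (P u * Q u) =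
          (1 - p) * (Ex p E' (fun F => if u ∈ cl F S then (1:ℝ) else 0) * (P u * Q u)) +
          p * (Ex p E' (fun F => if u ∈ cl F (insert y S) then (1:ℝ) else 0) * (P u * Q u)) := by
        intro u; ring
      simp only [h3]
      rw [Finset.sum_add_distrib, ← Finset.mul_sum, ← Finset.mul_sum, h2]; ring
    rw [hsum]
    have k1 := mul_le_mul_of_nonneg_left ih1 (by linarith : 0 ≤ 1 - p)
    have k2 := mul_le_mul_of_nonneg_left ih2 hp0
    have k3 : (a - a') * (b - b') ≤ P y * Q y :=
      mul_le_mul (by linarith) (by linarith) (by linarith) (by linarith)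
    have k5 : 0 ≤ (a - a') * (b - b') := mul_nonneg (by linarith) (by linarith)
    have k4 : p * (1 - p) * ((a - a') * (b - b')) ≤ p * (P y * Q y) := by
      rw [mul_assoc]
      apply mul_le_mul_of_nonneg_left _ hp0
      nlinarith
    nlinarith
  · push Not at hex
    have hcl : ∀ F, F ⊆ E → cl F S = S := fun F hF => cl_closed_eq fun a b ha hab => by
      by_contra hb
      exact hex a b ha hb (hF hab)
    rw [Ex_congr p E (g := fun _ => φ S * ψ S) (fun F hF => by rw [hcl F hF]),
      Ex_congr p E (f := fun F => φ (cl F S)) (g := fun _ => φ S) (fun F hF => by rw [hcl F hF]),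
      Ex_congr p E (f := fun F => ψ (cl F S)) (g := fun _ => ψ S) (fun F hF => by rw [hcl F hF])]
    simp only [Ex_const]
    have : 0 ≤ ∑ u ∈ Finset.univ \ S, Ex p E (fun F => if u ∈ cl F S then 1 else 0) * (P u * Q u) := by
      apply Finset.sum_nonneg
      intro u hu
      have hu' : u ∉ S := by simpa using hu
      rw [Ex_congr p E (g := fun _ => 0), Ex_const, zero_mul]
      intro F hF
      rw [hcl F hF, if_neg hu']
    linarith

end ClSec

section MmSec
variable {V : Type*} [Fintype V] [DecidableEq V]

/-- Probability that a set `C` contains a green vertex. -/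
def mm (γ : ℝ) (C : Finset V) : ℝ := 1 - (1 - γ) ^ C.card

/-- `|C| (1-γ)^{|C|}` -/
def f0 (γ : ℝ) (C : Finset V) : ℝ := C.card * (1 - γ) ^ C.card

/-- two-point function -/
def tt (p : ℝ) (E : Finset (Sym2 V)) (x y : V) : ℝ :=
  Ex p E (fun F => if y ∈ cl F {x} then 1 else 0)

lemma mm_nonneg {γ : ℝ} (h0 : 0 ≤ γ) (h1 : γ ≤ 1) (C : Finset V) : 0 ≤ mm γ C := by
  have := pow_le_one₀ (n := C.card) (by linarith : 0 ≤ 1 - γ) (by linarith)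
  unfold mm; linarith

lemma mm_mono {γ : ℝ} (h0 : 0 ≤ γ) (h1 : γ ≤ 1) {C D : Finset V} (h : C ⊆ D) :
    mm γ C ≤ mm γ D := by
  have := pow_le_pow_of_le_one (by linarith : 0 ≤ 1 - γ) (by linarith) (Finset.card_le_card h)
  unfold mm; linarith

lemma mm_union {γ : ℝ} (h0 : 0 ≤ γ) (h1 : γ ≤ 1) (C D : Finset V) :
    mm γ (C ∪ D) ≤ mm γ C + mm γ D := by
  have a := pow_le_pow_of_le_one (by linarith : 0 ≤ 1 - γ) (by linarith) (Finset.card_union_le C D)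
  have b := mul_nonneg (mm_nonneg h0 h1 C) (mm_nonneg h0 h1 D)
  rw [pow_add] at a
  unfold mm at *; nlinarith

lemma mm_biUnion {γ : ℝ} (h0 : 0 ≤ γ) (h1 : γ ≤ 1) (s : Finset V) (t : V → Finset V) :
    mm γ (s.biUnion t) ≤ ∑ w ∈ s, mm γ (t w) := by
  induction s using Finset.induction_on with
  | empty => simp [mm]
  | insert a s ha ih =>
    rw [Finset.biUnion_insert, Finset.sum_insert ha]
    exact (mm_union h0 h1 _ _).trans (by linarith)

lemma f0_nonneg {γ : ℝ} (h1 : γ ≤ 1) (C : Finset V) : 0 ≤ f0 γ C := by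
  have : 0 ≤ 1 - γ := by linarith
  unfold f0; positivity

lemma f0_le {γ : ℝ} (h0 : 0 ≤ γ) (h1 : γ ≤ 1) (C : Finset V) : γ * f0 γ C ≤ mm γ C := by
  unfold f0 mm
  generalize C.card = k
  induction k with
  | zero => simp
  | succ k ih =>
    have hq : 0 ≤ 1 - γ := by linarith
    have a := mul_le_mul_of_nonneg_left ih hq
    have b : (1 - γ) ^ (k + 1) ≤ 1 := pow_le_one₀ hq (by linarith)
    have c := mul_nonneg h0 (sub_nonneg.2 b)
    push_cast
    rw [pow_succ] at *
    nlinarith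

lemma tt_nonneg {p : ℝ} (hp0 : 0 ≤ p) (hp1 : p ≤ 1) (E : Finset (Sym2 V)) (x y : V) :
    0 ≤ tt p E x y := Ex_nonneg hp0 hp1 _ fun F _ => by positivity

lemma tt_self (p : ℝ) (E : Finset (Sym2 V)) (x : V) : tt p E x x = 1 := by
  unfold tt; simp only [self_mem_cl, if_true, Ex_const]

lemma tt_symm (p : ℝ) (E : Finset (Sym2 V)) (x y : V) : tt p E x y = tt p E y x := by
  unfold tt; congr 1; ext F
  have : y ∈ cl F {x} ↔ x ∈ cl F {y} := ⟨cl_symm, cl_symm⟩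
  simp only [this]

lemma Ex_marg (p : ℝ) {E' E : Finset (Sym2 V)} (hE : E' ⊆ E) (f : Finset (Sym2 V) → ℝ)
    (h : ∀ e ∈ E, e ∉ E' → ∀ F, f (insert e F) = f F) : Ex p E' f = Ex p E f := by
  have key : ∀ D : Finset (Sym2 V), D ⊆ E → Disjoint D E' → Ex p (D ∪ E') f = Ex p E' f := by
    intro D
    induction D using Finset.induction_on with
    | empty => simp
    | insert e D he ih =>
      intro hD hdis
      have heE : e ∉ E' := Finset.disjoint_left.1 hdis (Finset.mem_insert_self _ _)
      rw [Finset.insert_union, Ex_insert p (by simp [he, heE])]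
      simp only [h e (hD (Finset.mem_insert_self _ _)) heE]
      rw [ih ((Finset.subset_insert _ _).trans hD)
        (Finset.disjoint_of_subset_left (Finset.subset_insert _ _) hdis)]
      ring
  have := key (E \ E') Finset.sdiff_subset Finset.sdiff_disjoint
  rw [Finset.sdiff_union_of_subset hE] at this
  exact this.symm

/-- tree-graph bound for a vertex and the ghost -/
lemma tree_ghost {p γ M : ℝ} (hp0 : 0 ≤ p) (hp1 : p ≤ 1) (h0 : 0 ≤ γ) (h1 : γ ≤ 1)
    {E' E : Finset (Sym2 V)} (hE : E' ⊆ E)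
    (hM : ∀ x, Ex p E (fun F => mm γ (cl F {x})) = M) (y w : V) :
    Ex p E' (fun F => (if w ∈ cl F {y} then 1 else 0) * mm γ (cl F {y})) ≤
      (∑ u, tt p E y u * tt p E u w) * M := by
  have hmono : Ex p E' (fun F => (if w ∈ cl F {y} then 1 else 0) * mm γ (cl F {y})) ≤
      Ex p E (fun F => (if w ∈ cl F {y} then 1 else 0) * mm γ (cl F {y})) := by
    apply Ex_mono_set hp0 hp1 hE
    intro F F' hF
    have hc : cl F {y} ⊆ cl F' {y} := cl_mono hF (Finset.Subset.refl _)
    have hm := mm_mono h0 h1 hc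
    have hn := mm_nonneg h0 h1 (cl F {y})
    by_cases hw : w ∈ cl F {y}
    · rw [if_pos hw, if_pos (hc hw)]; linarith
    · rw [if_neg hw, zero_mul]
      split_ifs
      · linarith
      · simp
  refine hmono.trans ?_
  have := Ex_cov hp0 hp1 (fun C : Finset V => if w ∈ C then (1:ℝ) else 0) (mm γ)
    (by
      intro C D h
      by_cases hw : w ∈ C
      · simp [hw, h hw]
      · simp only [hw, if_false]; positivity)
    (by
      intro C D
      by_cases hw : w ∈ C <;> by_cases hw' : w ∈ D <;> simp [hw, hw'])
    (fun C D h => mm_mono h0 h1 h) (mm_union h0 h1) (fun u => tt p E u w) (fun _ => M) E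
    (by
      intro E' hE' u
      apply Ex_mono_set hp0 hp1 hE'
      intro F F' hF
      have hc : cl F {u} ⊆ cl F' {u} := cl_mono hF (Finset.Subset.refl _)
      by_cases hw : w ∈ cl F {u}
      · simp [hw, hc hw]
      · simp only [hw, if_false]; positivity)
    (by
      intro E' hE' u
      rw [← hM u]
      apply Ex_mono_set hp0 hp1 hE'
      intro F F' hF
      exact mm_mono h0 h1 (cl_mono hF (Finset.Subset.refl _)))
    {y}
  refine this.trans (le_of_eq ?_)
  rw [hM]
  change tt p E y w * M + ∑ u ∈ Finset.univ \ {y}, tt p E y u * (tt p E u w * M) = _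
  rw [Finset.sum_mul, ← Finset.sum_sdiff (Finset.subset_univ ({y} : Finset V)),
    Finset.sum_singleton, tt_self, one_mul, add_comm]
  congr 1
  apply Finset.sum_congr rfl
  intros; ring

/-- avoiding a set `A` costs at most `∑_{w ∈ A} τ(z,w) M` -/
lemma hit {p γ M : ℝ} (hp0 : 0 ≤ p) (hp1 : p ≤ 1) (h0 : 0 ≤ γ) (h1 : γ ≤ 1)
    {E : Finset (Sym2 V)}
    (hM : ∀ x, Ex p E (fun F => mm γ (cl F {x})) = M) (z : V) (A : Finset V) :
    M - (∑ w ∈ A, tt p E z w) * M ≤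
      Ex p E (fun F => if z ∉ A then mm γ (cl (off F A) {z}) else 0) := by
  have hM0 : 0 ≤ M := by
    rw [← hM z]; exact Ex_nonneg hp0 hp1 _ fun F _ => mm_nonneg h0 h1 _
  by_cases hz : z ∈ A
  · have : (1:ℝ) ≤ ∑ w ∈ A, tt p E z w := by
      rw [← tt_self p E z]
      exact Finset.single_le_sum (f := fun w => tt p E z w) (fun w _ => tt_nonneg hp0 hp1 E z w) hz
    simp only [hz, not_true_eq_false, if_false, Ex_const]
    nlinarith
  simp only [hz, not_false_eq_true, if_true]
  set st : Finset (Sym2 V) → Finset V := fun F => cl (off F A) {z} with hst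
  let g : V → Finset (Sym2 V) → ℝ := fun w F => if ∃ a ∈ st F, s(a, w) ∈ F then 1 else 0
  let h : V → Finset V → Finset (Sym2 V) → ℝ := fun w U F => mm γ (cl (off F U) {w})
  have hpt : ∀ F, mm γ (cl F {z}) ≤ mm γ (st F) + ∑ w ∈ A, g w F * h w (st F) F := by
    intro F
    set B := A.filter (fun w => ∃ a ∈ st F, s(a, w) ∈ F)
    have hsub : cl F {z} ⊆ st F ∪ B.biUnion (fun w => cl (off F (st F)) {w}) := by
      apply cl_min
      · intro a ha
        rw [Finset.mem_singleton.1 ha]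
        exact Finset.mem_union_left _ (self_mem_cl _ _)
      · intro a b ha hab
        by_cases hb : b ∈ st F
        · exact Finset.mem_union_left _ hb
        apply Finset.mem_union_right
        by_cases ha' : a ∈ st F
        · have hbA : b ∈ A := by
            by_contra hbA
            apply hb
            have haA : a ∉ A := by
              have : st F ⊆ Finset.univ \ A := by
                apply cl_min
                · simpa using hz
                · intro c d _ hcd
                  simpa using (mem_off.1 hcd).2.2
              simpa using this ha'
            exact cl_step ha' (mem_off.2 ⟨hab, haA, hbA⟩)
          exact Finset.mem_biUnion.2 ⟨b, Finset.mem_filter.2 ⟨hbA, a, ha', hab⟩, self_mem_cl _ _⟩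
        · rcases Finset.mem_union.1 ha with h | h
          · exact absurd h ha'
          obtain ⟨w, hw, haw⟩ := Finset.mem_biUnion.1 h
          exact Finset.mem_biUnion.2 ⟨w, hw, cl_step haw (mem_off.2 ⟨hab, ha', hb⟩)⟩
    refine (mm_mono h0 h1 hsub).trans ((mm_union h0 h1 _ _).trans ?_)
    refine add_le_add_right ((mm_biUnion h0 h1 _ _).trans (le_of_eq ?_)) _
    rw [Finset.sum_filter]
    apply Finset.sum_congr rfl
    intro w _
    simp only [g, h]
    split_ifs <;> simp
  have hE1 : M ≤ Ex p E (fun F => mm γ (st F)) + ∑ w ∈ A, Ex p E (fun F => g w F * h w (st F) F) := by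
    rw [← hM z, ← Ex_sum, ← Ex_add]
    exact Ex_mono hp0 hp1 _ fun F _ => hpt F
  have hE2 : ∀ w ∈ A, Ex p E (fun F => g w F * h w (st F) F) ≤ tt p E z w * M := by
    intro w _
    have e1 : ∀ F, st (tch F (st F)) = st F := by
      intro F
      simp only [hst]
      rw [off_tch_comm]
      exact cl_tch (Finset.Subset.refl _)
    rw [Ex_markov p E st (g w) (h w)]
    · unfold tt
      rw [← Ex_mul_right]
      apply Ex_mono hp0 hp1
      intro F _
      have hb : Ex p E (h w (st F)) ≤ M := by
        rw [← hM w]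
        exact Ex_mono hp0 hp1 _ fun F' _ => mm_mono h0 h1 (cl_mono (off_subset _ _) (Finset.Subset.refl _))
      simp only [g]
      by_cases hw : ∃ a ∈ st F, s(a, w) ∈ F
      · obtain ⟨a, ha, haw⟩ := hw
        have : w ∈ cl F {z} := cl_step (cl_mono (off_subset _ _) (Finset.Subset.refl _) ha) haw
        rw [if_pos ⟨a, ha, haw⟩, if_pos this]; linarith
      · rw [if_neg hw, zero_mul]; positivity
    · intro F
      refine ⟨e1 F, ?_⟩
      simp only [g, e1 F]
      congr 1
      apply propext
      constructor
      · rintro ⟨a, ha, haw⟩; exact ⟨a, ha, tch_subset _ _ haw⟩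
      · rintro ⟨a, ha, haw⟩; exact ⟨a, ha, mem_tch.2 ⟨haw, Or.inl ha⟩⟩
    · intro F U hU
      simp only [hst] at hU ⊢
      rw [off_tch_comm] at hU
      exact cl_of_tch hU
    · intro U F
      simp only [h, off_off]
  have := Finset.sum_le_sum hE2
  rw [← Finset.sum_mul] at this
  linarith

end MmSec

section ISec
variable {V : Type*} [Fintype V] [DecidableEq V]

/-- The integrand of the branching event. -/
def JJ (γ : ℝ) (v y z : V) (F : Finset (Sym2 V)) : ℝ :=
  (f0 γ (cl F {v}) * (if y ∉ cl F {v} then mm γ (cl F {y}) else 0)) *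
    (if z ∉ cl F {v, y} then mm γ (cl F {z}) else 0)

lemma markov_cl (p : ℝ) (E : Finset (Sym2 V)) (S : Finset V)
    (g : Finset (Sym2 V) → ℝ) (h : Finset V → Finset (Sym2 V) → ℝ)
    (hg : ∀ F, g (tch F (cl F S)) = g F) (hh : ∀ U F, h U F = h U (off F U)) :
    Ex p E (fun F => g F * h (cl F S) F) = Ex p E (fun F => g F * Ex p E (h (cl F S))) :=
  Ex_markov p E (fun F => cl F S) g h
    (fun F => ⟨cl_tch (Finset.Subset.refl _), hg F⟩) (fun _ _ hU => cl_of_tch hU) hh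

lemma I_bound {p γ M : ℝ} (hp0 : 0 ≤ p) (hp1 : p ≤ 1) (h0 : 0 ≤ γ) (h1 : γ ≤ 1)
    {E' E : Finset (Sym2 V)} (hE : E' ⊆ E)
    (hM : ∀ x, Ex p E (fun F => mm γ (cl F {x})) = M) (v y z : V)
    (hEv : ∀ e ∈ E, e ∉ E' → v ∈ e) {a : ℝ}
    (hyz : ∑ u, ∑ w, tt p E y u * tt p E u w * tt p E w z ≤ a)
    (hvy : ∑ u, ∑ w, tt p E v u * tt p E u w * tt p E w y ≤ a)
    (hvz : ∑ u, ∑ w, tt p E v u * tt p E u w * tt p E w z ≤ a) :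
    M ^ 2 * ((1 - a) * (γ * Ex p E' (fun F => f0 γ (cl F {v}))) - 2 * a * M) ≤
      γ * Ex p E' (JJ γ v y z) := by
  have hM0 : 0 ≤ M := by
    rw [← hM z]; exact Ex_nonneg hp0 hp1 _ fun F _ => mm_nonneg h0 h1 _
  -- the generic avoidance bound on the smaller edge set
  have hav : ∀ (x : V) (U : Finset V), v ∈ U → M - (∑ w ∈ U, tt p E x w) * M ≤
      Ex p E' (fun F => if x ∉ U then mm γ (cl (off F U) {x}) else 0) := by
    intro x U hvU
    refine (hit hp0 hp1 h0 h1 hM x U).trans (le_of_eq ?_)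
    refine (Ex_marg p hE _ ?_).symm
    intro e he he' F
    have : off (insert e F) U = off F U := by
      unfold off
      rw [Finset.filter_insert, if_neg]
      exact not_not.2 ⟨v, hvU, hEv e he he'⟩
    rw [this]
  have hup : ∀ (x : V) (U : Finset V),
      Ex p E' (fun F => if x ∉ U then mm γ (cl (off F U) {x}) else 0) ≤ M := by
    intro x U
    rw [← hM x]
    refine le_trans ?_ (Ex_mono_set hp0 hp1 hE (f := fun F => mm γ (cl F {x}))
      fun F F' hF => mm_mono h0 h1 (cl_mono hF (Finset.Subset.refl _)))
    apply Ex_mono hp0 hp1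
    intro F _
    split_ifs
    · exact mm_nonneg h0 h1 _
    · exact mm_mono h0 h1 (cl_mono (off_subset _ _) (Finset.Subset.refl _))
  set g : Finset (Sym2 V) → ℝ := fun F =>
    f0 γ (cl F {v}) * (if y ∉ cl F {v} then mm γ (cl F {y}) else 0) with hgdef
  have hg0 : ∀ F, 0 ≤ g F := by
    intro F
    apply mul_nonneg (f0_nonneg h1 _)
    split_ifs
    · exact le_rfl
    · exact mm_nonneg h0 h1 _
  set X' := Ex p E' (fun F => f0 γ (cl F {v})) with hX'
  have hX0 : 0 ≤ X' := Ex_nonneg hp0 hp1 _ fun F _ => f0_nonneg h1 _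
  have hv2 : ({v} : Finset V) ⊆ {v, y} := by simp
  have hy2 : ({y} : Finset V) ⊆ {v, y} := by simp
  -- step 1
  have s1 : Ex p E' (fun F => g F * (M - (∑ w, tt p E z w * (if w ∈ cl F {v} then 1 else 0)
      + ∑ w, tt p E z w * (if w ∈ cl F {y} then 1 else 0)) * M)) ≤ Ex p E' (JJ γ v y z) := by
    have e1 : Ex p E' (JJ γ v y z) = Ex p E' (fun F => g F *
        Ex p E' (fun F' => if z ∉ cl F {v, y} then mm γ (cl (off F' (cl F {v, y})) {z}) else 0)) := by
      rw [← markov_cl p E' {v, y} g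
        (fun U F => if z ∉ U then mm γ (cl (off F U) {z}) else 0)]
      · apply Ex_congr
        intro F _
        unfold JJ
        simp only [hgdef]
        congr 1
        split_ifs with hz
        · rfl
        · rw [cl_off hz]
      · intro F
        simp only [hgdef, cl_tch hv2, cl_tch hy2]
      · intro U F
        simp only [off_off]
    rw [e1]
    apply Ex_mono hp0 hp1
    intro F _
    apply mul_le_mul_of_nonneg_left _ (hg0 F)
    refine le_trans ?_ (hav z (cl F {v, y}) (subset_cl _ _ (by simp)))
    have : ∑ w ∈ cl F {v, y}, tt p E z w ≤
        ∑ w, tt p E z w * (if w ∈ cl F {v} then 1 else 0)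
      + ∑ w, tt p E z w * (if w ∈ cl F {y} then 1 else 0) := by
      have hU : cl F {v, y} = cl F {v} ∪ cl F {y} := by
        rw [← cl_union]; rfl
      rw [hU, ← Finset.sum_add_distrib, ← Finset.sum_filter_add_sum_filter_not Finset.univ (fun w => w ∈ cl F {v} ∪ cl F {y})]
      have h2 : 0 ≤ ∑ w ∈ Finset.univ.filter (fun w => w ∉ cl F {v} ∪ cl F {y}),
          (tt p E z w * (if w ∈ cl F {v} then 1 else 0)
            + tt p E z w * (if w ∈ cl F {y} then 1 else 0)) := by
        apply Finset.sum_nonneg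
        intro w _
        have := tt_nonneg hp0 hp1 E z w
        positivity
      have h3 : ∑ w ∈ cl F {v} ∪ cl F {y}, tt p E z w ≤
          ∑ w ∈ Finset.univ.filter (fun w => w ∈ cl F {v} ∪ cl F {y}),
          (tt p E z w * (if w ∈ cl F {v} then 1 else 0)
            + tt p E z w * (if w ∈ cl F {y} then 1 else 0)) := by
        rw [Finset.filter_univ_mem]
        apply Finset.sum_le_sum
        intro w hw
        have := tt_nonneg hp0 hp1 E z w
        rcases Finset.mem_union.1 hw with h | h
        · rw [if_pos h]; split_ifs <;> linarith
        · rw [if_pos h]; split_ifs <;> linarith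
      linarith
    have := mul_le_mul_of_nonneg_right this hM0
    linarith
  -- expand
  have s2 : Ex p E' (fun F => g F * (M - (∑ w, tt p E z w * (if w ∈ cl F {v} then 1 else 0)
      + ∑ w, tt p E z w * (if w ∈ cl F {y} then 1 else 0)) * M)) =
      M * Ex p E' g - M * ∑ w, tt p E z w * Ex p E' (fun F => g F * (if w ∈ cl F {v} then 1 else 0))
        - M * ∑ w, tt p E z w * Ex p E' (fun F => g F * (if w ∈ cl F {y} then 1 else 0)) := by
    have : ∀ F, g F * (M - (∑ w, tt p E z w * (if w ∈ cl F {v} then (1:ℝ) else 0)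
      + ∑ w, tt p E z w * (if w ∈ cl F {y} then 1 else 0)) * M) =
      M * g F - M * (∑ w, tt p E z w * (g F * (if w ∈ cl F {v} then 1 else 0)))
        - M * ∑ w, tt p E z w * (g F * (if w ∈ cl F {y} then 1 else 0)) := by
      intro F
      have k : ∀ x : V, ∑ w, tt p E z w * (g F * (if w ∈ cl F {x} then (1:ℝ) else 0)) =
          g F * ∑ w, tt p E z w * (if w ∈ cl F {x} then (1:ℝ) else 0) := by
        intro x; rw [Finset.mul_sum]; apply Finset.sum_congr rfl; intros; ring
      rw [k, k]; ring
    simp only [this]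
    rw [Ex_sub, Ex_sub, Ex_mul_left, Ex_mul_left, Ex_mul_left, Ex_sum, Ex_sum]
    simp only [Ex_mul_left]
  have hT := fun w => tree_ghost hp0 hp1 h0 h1 hE hM v w
  -- γ E[f0 1(w∈A)] bound
  have s3 : ∀ w, γ * Ex p E' (fun F => f0 γ (cl F {v}) * (if w ∈ cl F {v} then 1 else 0)) ≤
      (∑ u, tt p E v u * tt p E u w) * M := by
    intro w
    refine le_trans ?_ (hT w)
    rw [← Ex_mul_left]
    apply Ex_mono hp0 hp1
    intro F _
    have := f0_le h0 h1 (cl F {v})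
    split_ifs
    · linarith
    · simp
  -- first term
  have s4 : M * X' - M * ∑ w, tt p E y w *
      Ex p E' (fun F => f0 γ (cl F {v}) * (if w ∈ cl F {v} then 1 else 0)) ≤ Ex p E' g := by
    have e1 : Ex p E' g = Ex p E' (fun F => f0 γ (cl F {v}) *
        Ex p E' (fun F' => if y ∉ cl F {v} then mm γ (cl (off F' (cl F {v})) {y}) else 0)) := by
      rw [← markov_cl p E' {v} (fun F => f0 γ (cl F {v}))
        (fun U F => if y ∉ U then mm γ (cl (off F U) {y}) else 0)]
      · apply Ex_congr
        intro F _
        simp only [hgdef]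
        congr 1
        split_ifs with hz
        · rfl
        · rw [cl_off hz]
      · intro F
        simp only [cl_tch (Finset.Subset.refl _)]
      · intro U F
        simp only [off_off]
    have e2 : M * X' - M * ∑ w, tt p E y w *
      Ex p E' (fun F => f0 γ (cl F {v}) * (if w ∈ cl F {v} then 1 else 0)) =
      Ex p E' (fun F => f0 γ (cl F {v}) * (M - (∑ w ∈ cl F {v}, tt p E y w) * M)) := by
      have : ∀ F, f0 γ (cl F {v}) * (M - (∑ w ∈ cl F {v}, tt p E y w) * M) =
          M * f0 γ (cl F {v}) -
          M * ∑ w, tt p E y w * (f0 γ (cl F {v}) * (if w ∈ cl F {v} then 1 else 0)) := by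
        intro F
        have k : ∑ w, tt p E y w * (f0 γ (cl F {v}) * (if w ∈ cl F {v} then (1:ℝ) else 0)) =
          f0 γ (cl F {v}) * ∑ w ∈ cl F {v}, tt p E y w := by
          rw [Finset.mul_sum, ← Finset.sum_filter_add_sum_filter_not Finset.univ (fun w => w ∈ cl F {v}),
            Finset.filter_univ_mem]
          rw [Finset.sum_eq_zero (s := Finset.univ.filter fun w => w ∉ cl F {v}), add_zero]
          · apply Finset.sum_congr rfl
            intro w hw; rw [if_pos hw]; ring
          · intro w hw
            rw [if_neg (Finset.mem_filter.1 hw).2]; ring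
        rw [k]; ring
      simp only [this]
      rw [Ex_sub, Ex_mul_left, Ex_mul_left, Ex_sum]
      simp only [Ex_mul_left, ← hX']
    rw [e1, e2]
    apply Ex_mono hp0 hp1
    intro F _
    exact mul_le_mul_of_nonneg_left (hav y _ (self_mem_cl _ _)) (f0_nonneg h1 _)
  -- second term
  have s5 : ∀ w, Ex p E' (fun F => g F * (if w ∈ cl F {v} then 1 else 0)) ≤
      M * Ex p E' (fun F => f0 γ (cl F {v}) * (if w ∈ cl F {v} then 1 else 0)) := by
    intro w
    have e1 : Ex p E' (fun F => g F * (if w ∈ cl F {v} then 1 else 0)) =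
        Ex p E' (fun F => (f0 γ (cl F {v}) * (if w ∈ cl F {v} then 1 else 0)) *
        Ex p E' (fun F' => if y ∉ cl F {v} then mm γ (cl (off F' (cl F {v})) {y}) else 0)) := by
      rw [← markov_cl p E' {v} (fun F => f0 γ (cl F {v}) * (if w ∈ cl F {v} then 1 else 0))
        (fun U F => if y ∉ U then mm γ (cl (off F U) {y}) else 0)]
      · apply Ex_congr
        intro F _
        simp only [hgdef]
        by_cases hz : y ∈ cl F {v}
        · simp [hz]
        · simp only [hz, not_false_eq_true, if_true]; rw [cl_off hz]; ring
      · intro F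
        simp only [cl_tch (Finset.Subset.refl _)]
      · intro U F
        simp only [off_off]
    rw [e1, ← Ex_mul_left]
    apply Ex_mono hp0 hp1
    intro F _
    rw [mul_comm M]
    apply mul_le_mul_of_nonneg_left (hup y _)
    exact mul_nonneg (f0_nonneg h1 _) (by positivity)
  -- third term
  have s6 : ∀ w, Ex p E' (fun F => g F * (if w ∈ cl F {y} then 1 else 0)) ≤
      X' * ((∑ u, tt p E y u * tt p E u w) * M) := by
    intro w
    have e1 : Ex p E' (fun F => g F * (if w ∈ cl F {y} then 1 else 0)) =
        Ex p E' (fun F => f0 γ (cl F {v}) *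
        Ex p E' (fun F' => if y ∉ cl F {v} then
          (if w ∈ cl (off F' (cl F {v})) {y} then 1 else 0) *
            mm γ (cl (off F' (cl F {v})) {y}) else 0)) := by
      rw [← markov_cl p E' {v} (fun F => f0 γ (cl F {v}))
        (fun U F => if y ∉ U then (if w ∈ cl (off F U) {y} then 1 else 0) *
          mm γ (cl (off F U) {y}) else 0)]
      · apply Ex_congr
        intro F _
        simp only [hgdef]
        by_cases hz : y ∈ cl F {v}
        · simp [hz]
        · simp only [hz, not_false_eq_true, if_true]; rw [cl_off hz]; ring
      · intro F
        simp only [cl_tch (Finset.Subset.refl _)]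
      · intro U F
        simp only [off_off]
    rw [e1, hX', ← Ex_mul_right]
    apply Ex_mono hp0 hp1
    intro F _
    apply mul_le_mul_of_nonneg_left _ (f0_nonneg h1 _)
    refine le_trans ?_ (tree_ghost hp0 hp1 h0 h1 hE hM y w)
    apply Ex_mono hp0 hp1
    intro F' _
    have hc : cl (off F' (cl F {v})) {y} ⊆ cl F' {y} :=
      cl_mono (off_subset _ _) (Finset.Subset.refl _)
    have hm := mm_mono h0 h1 hc
    have hn := mm_nonneg h0 h1 (cl (off F' (cl F {v})) {y})
    have hn' := mm_nonneg h0 h1 (cl F' {y})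
    by_cases k1 : y ∈ cl F {v}
    · rw [if_neg (not_not.2 k1)]
      exact mul_nonneg (by positivity) hn'
    · rw [if_pos k1]
      by_cases k2 : w ∈ cl (off F' (cl F {v})) {y}
      · rw [if_pos k2, if_pos (hc k2)]; linarith
      · rw [if_neg k2, zero_mul]
        exact mul_nonneg (by positivity) hn'
  have tri : ∀ x x' : V, ∑ w, tt p E x' w * ((∑ u, tt p E x u * tt p E u w) * M) =
      (∑ u, ∑ w, tt p E x u * tt p E u w * tt p E w x') * M := by
    intro x x'
    rw [Finset.sum_comm, Finset.sum_mul]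
    apply Finset.sum_congr rfl
    intro w _
    rw [tt_symm p E x' w, ← Finset.sum_mul]; ring
  have tn := fun x y => tt_nonneg hp0 hp1 E x y
  -- third
  have t3 : ∑ w, tt p E z w * Ex p E' (fun F => g F * (if w ∈ cl F {y} then 1 else 0)) ≤
      X' * (a * M) := by
    calc _ ≤ ∑ w, tt p E z w * (X' * ((∑ u, tt p E y u * tt p E u w) * M)) :=
          Finset.sum_le_sum fun w _ => mul_le_mul_of_nonneg_left (s6 w) (tn z w)
      _ = X' * ∑ w, tt p E z w * ((∑ u, tt p E y u * tt p E u w) * M) := by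
          rw [Finset.mul_sum]; apply Finset.sum_congr rfl; intros; ring
      _ ≤ X' * (a * M) := by
          rw [tri]
          exact mul_le_mul_of_nonneg_left (mul_le_mul_of_nonneg_right hyz hM0) hX0
  have tgen : ∀ x' : V, (∑ u, ∑ w, tt p E v u * tt p E u w * tt p E w x' ≤ a) →
      γ * ∑ w, tt p E x' w * Ex p E' (fun F => f0 γ (cl F {v}) * (if w ∈ cl F {v} then 1 else 0))
        ≤ a * M := by
    intro x' hx'
    calc _ = ∑ w, tt p E x' w * (γ *
          Ex p E' (fun F => f0 γ (cl F {v}) * (if w ∈ cl F {v} then 1 else 0))) := by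
          rw [Finset.mul_sum]; apply Finset.sum_congr rfl; intros; ring
      _ ≤ ∑ w, tt p E x' w * ((∑ u, tt p E v u * tt p E u w) * M) :=
          Finset.sum_le_sum fun w _ => mul_le_mul_of_nonneg_left (s3 w) (tn x' w)
      _ ≤ a * M := by
          rw [tri]; exact mul_le_mul_of_nonneg_right hx' hM0
  have t2 : γ * ∑ w, tt p E z w * Ex p E' (fun F => g F * (if w ∈ cl F {v} then 1 else 0)) ≤
      M * (a * M) := by
    calc _ ≤ γ * ∑ w, tt p E z w * (M *
          Ex p E' (fun F => f0 γ (cl F {v}) * (if w ∈ cl F {v} then 1 else 0))) :=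
          mul_le_mul_of_nonneg_left
            (Finset.sum_le_sum fun w _ => mul_le_mul_of_nonneg_left (s5 w) (tn z w)) h0
      _ = M * (γ * ∑ w, tt p E z w *
          Ex p E' (fun F => f0 γ (cl F {v}) * (if w ∈ cl F {v} then 1 else 0))) := by
          rw [Finset.mul_sum, Finset.mul_sum, Finset.mul_sum]
          apply Finset.sum_congr rfl; intros; ring
      _ ≤ M * (a * M) := mul_le_mul_of_nonneg_left (tgen z hvz) hM0
  have t1 := tgen y hvy
  have r1 := mul_le_mul_of_nonneg_left s4 (mul_nonneg h0 hM0)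
  have r2 := mul_le_mul_of_nonneg_left t2 hM0
  have r3 := mul_le_mul_of_nonneg_left t3 (mul_nonneg h0 hM0)
  have r4 := mul_le_mul_of_nonneg_left t1 (mul_nonneg hM0 hM0)
  have r5 := mul_le_mul_of_nonneg_left (s2 ▸ s1) h0
  have : M ^ 2 * ((1 - a) * (γ * X') - 2 * a * M) =
    M * M * (γ * X') - γ * M * (X' * (a * M)) - M * (M * (a * M)) - M * M * (a * M) := by ring
  rw [this]
  nlinarith [r1, r2, r3, r4, r5]

/-- removing two edges at `v` does not reduce `E f0` much -/
lemma X_bound {p γ M : ℝ} (hp0 : 0 ≤ p) (hp1 : p ≤ 1) (h0 : 0 ≤ γ) (h1 : γ ≤ 1)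
    {E : Finset (Sym2 V)} (hM : ∀ x, Ex p E (fun F => mm γ (cl F {x})) = M) (v y z : V)
    (hvy : s(v, y) ∈ E) (hvz : s(v, z) ∈ E) (hyz : y ≠ z) :
    γ * Ex p E (fun F => f0 γ (cl F {v})) - 4 * p * M ≤
      γ * Ex p ((E.erase s(v, y)).erase s(v, z)) (fun F => f0 γ (cl F {v})) := by
  have hM0 : 0 ≤ M := by
    rw [← hM z]; exact Ex_nonneg hp0 hp1 _ fun F _ => mm_nonneg h0 h1 _
  have hne : s(v, z) ≠ s(v, y) := by
    intro h; rcases Sym2.eq_iff.1 h with ⟨_, h⟩ | ⟨h, h'⟩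
    · exact hyz h.symm
    · exact hyz (by rw [← h, h'])
  set E1 := E.erase s(v, y) with hE1
  have hz1 : s(v, z) ∈ E1 := Finset.mem_erase.2 ⟨hne, hvz⟩
  -- one-step
  have step : ∀ (D : Finset (Sym2 V)) (x : V), D ⊆ E → s(v, x) ∈ D →
      γ * Ex p D (fun F => f0 γ (cl F {v})) - 2 * p * M ≤
        γ * Ex p (D.erase s(v, x)) (fun F => f0 γ (cl F {v})) := by
    intro D x hD hx
    conv_lhs => rw [← Finset.insert_erase hx]
    rw [Ex_insert p (Finset.notMem_erase _ _)]
    simp only [cl_insert_edge _ _ (Finset.mem_singleton_self v)]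
    have hD' : D.erase s(v, x) ⊆ E := (Finset.erase_subset _ _).trans hD
    have hb : γ * Ex p (D.erase s(v, x)) (fun F => f0 γ (cl F (insert x {v}))) ≤ 2 * M := by
      have hm : ∀ u, Ex p (D.erase s(v, x)) (fun F => mm γ (cl F {u})) ≤ M := by
        intro u
        rw [← hM u]
        exact Ex_mono_set hp0 hp1 hD' fun F F' hF => mm_mono h0 h1 (cl_mono hF (Finset.Subset.refl _))
      have : γ * Ex p (D.erase s(v, x)) (fun F => f0 γ (cl F (insert x {v}))) ≤
          Ex p (D.erase s(v, x)) (fun F => mm γ (cl F {x}))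
          + Ex p (D.erase s(v, x)) (fun F => mm γ (cl F {v})) := by
        rw [← Ex_mul_left, ← Ex_add]
        apply Ex_mono hp0 hp1
        intro F _
        refine (f0_le h0 h1 _).trans ?_
        have : cl F (insert x {v}) = cl F {x} ∪ cl F {v} := by rw [← cl_union]; rfl
        rw [this]; exact mm_union h0 h1 _ _
      linarith [hm x, hm v]
    have hn : 0 ≤ γ * Ex p (D.erase s(v, x)) (fun F => f0 γ (cl F {v})) :=
      mul_nonneg h0 (Ex_nonneg hp0 hp1 _ fun F _ => f0_nonneg h1 _)
    have := mul_le_mul_of_nonneg_left hb hp0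
    nlinarith
  have a1 := step E y (Finset.Subset.refl _) hvy
  have a2 := step E1 z (Finset.erase_subset _ _) hz1
  linarith

end ISec

section CombSec
variable {V : Type*} [Fintype V] [DecidableEq V]

/-- remove the two edges `vy`, `vz` -/
def rem (F : Finset (Sym2 V)) (v y z : V) : Finset (Sym2 V) := (F.erase s(v, y)).erase s(v, z)

lemma rem_subset (F : Finset (Sym2 V)) (v y z : V) : rem F v y z ⊆ F :=
  (Finset.erase_subset _ _).trans (Finset.erase_subset _ _)

lemma mem_rem_of_ne {F : Finset (Sym2 V)} {v y z a b : V} (h : s(a, b) ∈ F) (ha : v ≠ a)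
    (hb : v ≠ b) : s(a, b) ∈ rem F v y z := by
  unfold rem
  refine Finset.mem_erase.2 ⟨?_, Finset.mem_erase.2 ⟨?_, h⟩⟩
  · intro h'; rcases Sym2.eq_iff.1 h' with ⟨h1, _⟩ | ⟨_, h1⟩
    · exact ha h1.symm
    · exact hb h1.symm
  · intro h'; rcases Sym2.eq_iff.1 h' with ⟨h1, _⟩ | ⟨_, h1⟩
    · exact ha h1.symm
    · exact hb h1.symm

/-- The branching event: `v` is the branching vertex from `x` to the green set `Γ`. -/
structure Ev (F : Finset (Sym2 V)) (x : V) (Γ : Finset V) (v y z : V) : Prop where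
  hy : s(v, y) ∈ F
  hz : s(v, z) ∈ F
  hx : x ∈ cl (rem F v y z) {v}
  hA : Disjoint Γ (cl (rem F v y z) {v})
  hB : ¬ Disjoint Γ (cl (rem F v y z) {y})
  hD : ¬ Disjoint Γ (cl (rem F v y z) {z})
  hBD : z ∉ cl (rem F v y z) {y}

lemma avoid {F F1 : Finset (Sym2 V)} (hF : F1 ⊆ F) {v' y' z' t : V} (h : v' ∉ cl F1 {t}) :
    cl F1 {t} ⊆ cl (rem F v' y' z') {t} := by
  have : cl F1 {t} ⊆ cl F1 {t} ∩ cl (rem F v' y' z') {t} := by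
    apply cl_min
    · intro a ha
      rw [Finset.mem_singleton.1 ha]
      exact Finset.mem_inter.2 ⟨self_mem_cl _ _, self_mem_cl _ _⟩
    · intro a b ha hab
      obtain ⟨h1, h2⟩ := Finset.mem_inter.1 ha
      have hb := cl_step h1 hab
      refine Finset.mem_inter.2 ⟨hb, cl_step h2 (mem_rem_of_ne (hF hab) ?_ ?_)⟩
      · rintro rfl; exact h h1
      · rintro rfl; exact h hb
  exact this.trans Finset.inter_subset_right

lemma noG {F : Finset (Sym2 V)} {Γ : Finset V} {v y z v' y' z' t : V}
    (ht : s(v, t) ∈ rem F v' y' z') (hg : ¬ Disjoint Γ (cl (rem F v y z) {t}))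
    (hv' : v' ∉ cl (rem F v y z) {t}) (hv : v ∈ cl (rem F v' y' z') {v'})
    (hd : Disjoint Γ (cl (rem F v' y' z') {v'})) : False := by
  apply hg
  apply Finset.disjoint_of_subset_right _ hd
  intro a ha
  exact cl_trans (cl_step hv ht) (avoid (rem_subset _ _ _ _) hv' ha)

lemma Ev.y_notin {F : Finset (Sym2 V)} {x : V} {Γ : Finset V} {v y z : V} (h : Ev F x Γ v y z) :
    y ∉ cl (rem F v y z) {v} := by
  intro h'; apply h.hB; rw [cl_eq_of_mem h']; exact h.hA

lemma Ev.z_notin {F : Finset (Sym2 V)} {x : V} {Γ : Finset V} {v y z : V} (h : Ev F x Γ v y z) :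
    z ∉ cl (rem F v y z) {v} := by
  intro h'; apply h.hD; rw [cl_eq_of_mem h']; exact h.hA

lemma Ev.mem_cl {F : Finset (Sym2 V)} {x : V} {Γ : Finset V} {v y z v' y' z' : V}
    (h : Ev F x Γ v y z) (h' : Ev F x Γ v' y' z') : v' ∈ cl (rem F v y z) {v} := by
  by_contra hc
  have hvx : v ∈ cl (rem F v y z) {x} := cl_symm h.hx
  have hc' : v' ∉ cl (rem F v y z) {x} := by rw [cl_eq_of_mem h.hx]; exact hc
  have hv : v ∈ cl (rem F v' y' z') {v'} :=
    cl_trans h'.hx (avoid (rem_subset _ _ _ _) hc' hvx)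
  have hne : v' ≠ v := by rintro rfl; exact hc (self_mem_cl _ _)
  by_cases hy : v' ∈ cl (rem F v y z) {y}
  · have hz : v' ∉ cl (rem F v y z) {z} := fun hz => h.hBD (cl_trans hy (cl_symm hz))
    refine noG (mem_rem_of_ne h.hz hne ?_) h.hD hz hv h'.hA
    rintro rfl; exact hz (self_mem_cl _ _)
  · refine noG (mem_rem_of_ne h.hy hne ?_) h.hB hy hv h'.hA
    rintro rfl; exact hy (self_mem_cl _ _)

lemma Ev.v_eq {F : Finset (Sym2 V)} {x : V} {Γ : Finset V} {v y z v' y' z' : V}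
    (h : Ev F x Γ v y z) (h' : Ev F x Γ v' y' z') : v' = v := by
  by_contra hne
  have h1 := h.mem_cl h'
  have h2 := h'.mem_cl h
  have hy : v' ∉ cl (rem F v y z) {y} := fun hy => h.y_notin (cl_trans h1 (cl_symm hy))
  refine noG (mem_rem_of_ne h.hy hne ?_) h.hB hy h2 h'.hA
  rintro rfl; exact h.y_notin h1

lemma Ev.uniq {F : Finset (Sym2 V)} {x : V} {Γ : Finset V} {v y z v' y' z' : V}
    (h : Ev F x Γ v y z) (h' : Ev F x Γ v' y' z') :
    (v', y', z') = (v, y, z) ∨ (v', y', z') = (v, z, y) := by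
  obtain rfl := h.v_eq h'
  have key : ∀ t, s(v', t) ∈ F → t ∉ cl (rem F v' y z) {v'} →
      ¬ Disjoint Γ (cl (rem F v' y z) {t}) → t = y' ∨ t = z' := by
    intro t ht ht' hg
    by_contra hc
    push Not at hc
    refine noG (v' := v') (y' := y') (z' := z') ?_ hg (fun h => ht' (cl_symm h)) (self_mem_cl _ _) h'.hA
    have hn : ∀ t', t ≠ t' → s(v', t) ≠ s(v', t') := by
      intro t' htt h; rcases Sym2.eq_iff.1 h with ⟨_, h⟩ | ⟨h, h'⟩
      · exact htt h
      · exact htt (by rw [← h, h'])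
    exact Finset.mem_erase.2 ⟨hn _ hc.2, Finset.mem_erase.2 ⟨hn _ hc.1, ht⟩⟩
  have hyz : y ≠ z := by rintro rfl; exact h.hBD (self_mem_cl _ _)
  rcases key y h.hy h.y_notin h.hB with rfl | rfl <;> rcases key z h.hz h.z_notin h.hD with rfl | rfl
  · exact absurd rfl hyz
  · exact Or.inl rfl
  · exact Or.inr rfl
  · exact absurd rfl hyz

lemma Ev.green {F : Finset (Sym2 V)} {x : V} {Γ : Finset V} {v y z : V}
    (h : Ev F x Γ v y z) : ¬ Disjoint Γ (cl F {x}) := by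
  intro hd
  apply h.hB
  apply Finset.disjoint_of_subset_right _ hd
  have hv : v ∈ cl F {x} := cl_mono (rem_subset _ _ _ _) (Finset.Subset.refl _) (cl_symm h.hx)
  intro a ha
  exact cl_trans (cl_step hv h.hy) (cl_mono (rem_subset _ _ _ _) (Finset.Subset.refl _) ha)

lemma Ev_count (F : Finset (Sym2 V)) (x : V) (Γ : Finset V) :
    ∑ t : V × V × V, (if Ev F x Γ t.1 t.2.1 t.2.2 then (1:ℝ) else 0) ≤
      2 * (1 - if Disjoint Γ (cl F {x}) then (1:ℝ) else 0) := by
  by_cases hex : ∃ t : V × V × V, Ev F x Γ t.1 t.2.1 t.2.2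
  · obtain ⟨⟨v, y, z⟩, ht⟩ := hex
    rw [if_neg ht.green, ← Finset.sum_filter, Finset.sum_const, nsmul_eq_mul, mul_one]
    have : (Finset.univ.filter fun t : V × V × V => Ev F x Γ t.1 t.2.1 t.2.2) ⊆
        {(v, y, z), (v, z, y)} := by
      rintro ⟨v', y', z'⟩ h'
      have h'' := (Finset.mem_filter.1 h').2
      have := ht.uniq h''
      simpa using this
    have h2 := (Finset.card_le_card this).trans Finset.card_le_two
    have : ((Finset.univ.filter fun t : V × V × V => Ev F x Γ t.1 t.2.1 t.2.2).card : ℝ) ≤ 2 := by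
      exact_mod_cast h2
    linarith
  · push Not at hex
    rw [Finset.sum_eq_zero (fun t _ => if_neg (hex t))]
    split_ifs <;> norm_num

lemma JJ_le {γ : ℝ} (h0 : 0 ≤ γ) (h1 : γ ≤ 1) (F : Finset (Sym2 V)) (v y z : V) (hyz : y ≠ z) :
    (if s(v, y) ∈ F ∧ s(v, z) ∈ F then JJ γ v y z (rem F v y z) else 0) ≤
      ∑ x, Ex γ Finset.univ (fun Γ => if Ev F x Γ v y z then (1:ℝ) else 0) := by
  have hnn : 0 ≤ ∑ x, Ex γ Finset.univ (fun Γ => if Ev F x Γ v y z then (1:ℝ) else 0) :=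
    Finset.sum_nonneg fun x _ => Ex_nonneg h0 h1 _ fun Γ _ => by positivity
  by_cases hF : s(v, y) ∈ F ∧ s(v, z) ∈ F
  swap
  · rw [if_neg hF]; exact hnn
  rw [if_pos hF]
  unfold JJ
  set A := cl (rem F v y z) {v} with hA
  set B := cl (rem F v y z) {y} with hB
  set D := cl (rem F v y z) {z} with hD
  have hU : cl (rem F v y z) {v, y} = A ∪ B := by rw [hA, hB, ← cl_union]; rfl
  rw [hU]
  by_cases hy : y ∈ A
  · rw [if_neg (not_not.2 hy), mul_zero, zero_mul]; exact hnn
  by_cases hz : z ∈ A ∪ B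
  · rw [if_neg (not_not.2 hz), mul_zero]; exact hnn
  rw [if_pos hy, if_pos hz]
  rw [Finset.mem_union, not_or] at hz
  have dAB : Disjoint A B := Finset.disjoint_left.2 fun a ha hb => hy (cl_trans ha (cl_symm hb))
  have dAD : Disjoint A D := Finset.disjoint_left.2 fun a ha hb => hz.1 (cl_trans ha (cl_symm hb))
  have dBD : Disjoint B D := Finset.disjoint_left.2 fun a ha hb => hz.2 (cl_trans ha (cl_symm hb))
  have hx : ∀ x ∈ A, Ex γ Finset.univ (fun Γ => if Ev F x Γ v y z then (1:ℝ) else 0) =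
      (1 - γ) ^ A.card * (mm γ B * mm γ D) := by
    intro x hxA
    have e : ∀ Γ, (if Ev F x Γ v y z then (1:ℝ) else 0) =
        (if Disjoint Γ A then (1:ℝ) else 0) - (if Disjoint Γ (A ∪ B) then (1:ℝ) else 0)
        - (if Disjoint Γ (A ∪ D) then (1:ℝ) else 0)
        + (if Disjoint Γ (A ∪ B ∪ D) then (1:ℝ) else 0) := by
      intro Γ
      have : Ev F x Γ v y z ↔ Disjoint Γ A ∧ ¬ Disjoint Γ B ∧ ¬ Disjoint Γ D :=
        ⟨fun h => ⟨h.hA, h.hB, h.hD⟩, fun h => ⟨hF.1, hF.2, hxA, h.1, h.2.1, h.2.2, hz.2⟩⟩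
      simp only [this, Finset.disjoint_union_right]
      by_cases k1 : Disjoint Γ A <;> by_cases k2 : Disjoint Γ B <;> by_cases k3 : Disjoint Γ D <;>
        simp [k1, k2, k3]
    simp only [e]
    rw [Ex_add, Ex_sub, Ex_sub, Ex_void, Ex_void, Ex_void, Ex_void]
    simp only [Finset.inter_univ]
    rw [Finset.card_union_of_disjoint (Finset.disjoint_union_left.2 ⟨dAD, dBD⟩),
      Finset.card_union_of_disjoint dAB, Finset.card_union_of_disjoint dAD]
    unfold mm
    simp only [pow_add]; ring
  calc _ = ∑ x ∈ A, Ex γ Finset.univ (fun Γ => if Ev F x Γ v y z then (1:ℝ) else 0) := by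
        rw [Finset.sum_congr rfl hx, Finset.sum_const, nsmul_eq_mul]
        unfold f0; ring
    _ ≤ _ := Finset.sum_le_sum_of_subset_of_nonneg (Finset.subset_univ _)
        fun x _ _ => Ex_nonneg h0 h1 _ fun Γ _ => by positivity

lemma comb {γ : ℝ} (h0 : 0 ≤ γ) (h1 : γ ≤ 1) (F : Finset (Sym2 V)) :
    ∑ t : V × V × V, (if t.2.1 ≠ t.2.2 then
      (if s(t.1, t.2.1) ∈ F ∧ s(t.1, t.2.2) ∈ F then
        JJ γ t.1 t.2.1 t.2.2 (rem F t.1 t.2.1 t.2.2) else 0) else 0) ≤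
      2 * ∑ x, mm γ (cl F {x}) := by
  calc _ ≤ ∑ t : V × V × V, ∑ x, Ex γ Finset.univ
        (fun Γ => if Ev F x Γ t.1 t.2.1 t.2.2 then (1:ℝ) else 0) := by
        apply Finset.sum_le_sum
        intro t _
        split_ifs with hne
        · have := JJ_le h0 h1 F t.1 t.2.1 t.2.2 hne
          rwa [if_pos ‹_›] at this
        · exact Finset.sum_nonneg fun x _ => Ex_nonneg h0 h1 _ fun Γ _ => by positivity
        · exact Finset.sum_nonneg fun x _ => Ex_nonneg h0 h1 _ fun Γ _ => by positivity
    _ = ∑ x, Ex γ Finset.univ (fun Γ => ∑ t : V × V × V,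
          if Ev F x Γ t.1 t.2.1 t.2.2 then (1:ℝ) else 0) := by
        rw [Finset.sum_comm]
        apply Finset.sum_congr rfl
        intro x _
        rw [Ex_sum]
    _ ≤ ∑ x, 2 * mm γ (cl F {x}) := by
        apply Finset.sum_le_sum
        intro x _
        refine (Ex_mono h0 h1 _ fun Γ _ => Ev_count F x Γ).trans (le_of_eq ?_)
        rw [Ex_mul_left, Ex_sub, Ex_const, Ex_void, Finset.inter_univ]
        rfl
    _ = _ := by rw [Finset.mul_sum]

end CombSec

section MainIneq
variable {V : Type*} [Fintype V] [DecidableEq V]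

lemma sym_ne {v y z : V} (hyz : y ≠ z) : s(v, z) ≠ s(v, y) := by
  intro h; rcases Sym2.eq_iff.1 h with ⟨_, h⟩ | ⟨h, h'⟩
  · exact hyz h.symm
  · exact hyz (by rw [← h, h'])

lemma two_edge (p : ℝ) {E : Finset (Sym2 V)} {v y z : V} (hy : s(v, y) ∈ E) (hz : s(v, z) ∈ E)
    (hyz : y ≠ z) (g : Finset (Sym2 V) → ℝ) :
    Ex p E (fun F => if s(v, y) ∈ F ∧ s(v, z) ∈ F then g (rem F v y z) else 0) =
      p ^ 2 * Ex p (rem E v y z) g := by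
  have hne := sym_ne (v := v) hyz
  have h1 := Ex_mem_erase p hy (fun F => if s(v, z) ∈ F then g (F.erase s(v, z)) else 0)
  have h2 := Ex_mem_erase p (E := E.erase s(v, y)) (Finset.mem_erase.2 ⟨hne, hz⟩) g
  rw [h2] at h1
  unfold rem
  rw [pow_two, mul_assoc, ← h1]
  apply Ex_congr
  intro F _
  by_cases a : s(v, y) ∈ F <;> by_cases b : s(v, z) ∈ F <;> simp [a, b, hne]

lemma two_edge_not (p : ℝ) {E : Finset (Sym2 V)} {v y z : V}
    (h : ¬ (s(v, y) ∈ E ∧ s(v, z) ∈ E)) (g : Finset (Sym2 V) → ℝ) :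
    Ex p E (fun F => if s(v, y) ∈ F ∧ s(v, z) ∈ F then g (rem F v y z) else 0) = 0 := by
  refine (Ex_congr p E (g := fun _ => 0) ?_).trans (Ex_const p E 0)
  intro F hF
  have : ¬ (s(v, y) ∈ F ∧ s(v, z) ∈ F) := fun a => h ⟨hF a.1, hF a.2⟩
  rw [if_neg this]

lemma main_ineq {p γ M X a : ℝ} (hp0 : 0 ≤ p) (hp1 : p ≤ 1) (h0 : 0 ≤ γ) (h1 : γ ≤ 1)
    {E : Finset (Sym2 V)} [Nonempty V] (ha : a ≤ 1)
    (hloop : ∀ v, s(v, v) ∉ E) {Ω : ℕ}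
    (hN : ∀ v, (Finset.univ.filter fun y => s(v, y) ∈ E).card = Ω)
    (hM : ∀ x, Ex p E (fun F => mm γ (cl F {x})) = M)
    (hX : ∀ x, Ex p E (fun F => f0 γ (cl F {x})) = X)
    (htri : ∀ x y, x ≠ y → ∑ u, ∑ w, tt p E x u * tt p E u w * tt p E w y ≤ a) :
    (Ω : ℝ) * (Ω - 1) * p ^ 2 * (M ^ 2 * ((1 - a) * (γ * X - 4 * p * M) - 2 * a * M)) ≤
      2 * γ * M := by
  set B := M ^ 2 * ((1 - a) * (γ * X - 4 * p * M) - 2 * a * M) with hB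
  have key : ∀ t : V × V × V,
      (if t.2.1 ≠ t.2.2 ∧ s(t.1, t.2.1) ∈ E ∧ s(t.1, t.2.2) ∈ E then p ^ 2 * B else 0) ≤
      γ * Ex p E (fun F => if t.2.1 ≠ t.2.2 then
      (if s(t.1, t.2.1) ∈ F ∧ s(t.1, t.2.2) ∈ F then
        JJ γ t.1 t.2.1 t.2.2 (rem F t.1 t.2.1 t.2.2) else 0) else 0) := by
    rintro ⟨v, y, z⟩
    dsimp only
    by_cases hyz : y = z
    · simp [hyz, Ex_const]
    · simp only [ne_eq, hyz, not_false_eq_true, true_and, if_true]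
      by_cases hE : s(v, y) ∈ E ∧ s(v, z) ∈ E
      · rw [if_pos hE, two_edge p hE.1 hE.2 hyz]
        have hvy : v ≠ y := by rintro rfl; exact hloop _ hE.1
        have hvz : v ≠ z := by rintro rfl; exact hloop _ hE.2
        have hI := I_bound hp0 hp1 h0 h1 (rem_subset E v y z) hM v y z
          (by
            intro e he he'
            by_contra hv
            apply he'
            unfold rem
            refine Finset.mem_erase.2 ⟨?_, Finset.mem_erase.2 ⟨?_, he⟩⟩
            · rintro rfl; exact hv (Sym2.mem_mk_left _ _)
            · rintro rfl; exact hv (Sym2.mem_mk_left _ _))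
          (htri y z hyz) (htri v y hvy) (htri v z hvz)
        have hXb := X_bound hp0 hp1 h0 h1 hM v y z hE.1 hE.2 hyz
        rw [hX] at hXb
        have : B ≤ γ * Ex p (rem E v y z) (JJ γ v y z) := by
          refine le_trans ?_ hI
          rw [hB]
          apply mul_le_mul_of_nonneg_left _ (sq_nonneg M)
          have := mul_le_mul_of_nonneg_left hXb (by linarith : 0 ≤ 1 - a)
          unfold rem
          linarith
        nlinarith [mul_le_mul_of_nonneg_left this (sq_nonneg p)]
      · rw [if_neg hE, two_edge_not p hE]; simp
  have hsum := Finset.sum_le_sum (s := Finset.univ) fun t _ => key t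
  rw [← Finset.mul_sum, ← Ex_sum] at hsum
  have hc := Ex_mono hp0 hp1 E (fun F _ => comb h0 h1 F)
  have hs : Ex p E (fun F => ∑ x, mm γ (cl F {x})) = Fintype.card V * M := by
    rw [Ex_sum, Finset.sum_congr rfl fun x _ => hM x, Finset.sum_const,
      Finset.card_univ, nsmul_eq_mul]
  rw [Ex_mul_left, hs] at hc
  have hfin := hsum.trans (mul_le_mul_of_nonneg_left hc h0)
  have hcount : ∑ t : V × V × V,
      (if t.2.1 ≠ t.2.2 ∧ s(t.1, t.2.1) ∈ E ∧ s(t.1, t.2.2) ∈ E then p ^ 2 * B else 0) =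
      (Fintype.card V : ℝ) * ((Ω : ℝ) * (Ω - 1) * p ^ 2 * B) := by
    rw [Fintype.sum_prod_type]
    have : ∀ v : V, ∑ t : V × V,
        (if t.1 ≠ t.2 ∧ s(v, t.1) ∈ E ∧ s(v, t.2) ∈ E then p ^ 2 * B else 0) =
        (Ω : ℝ) * (Ω - 1) * p ^ 2 * B := by
      intro v
      rw [← Finset.sum_filter]
      have hf : (Finset.univ.filter fun t : V × V => t.1 ≠ t.2 ∧ s(v, t.1) ∈ E ∧ s(v, t.2) ∈ E) =
          (Finset.univ.filter fun y => s(v, y) ∈ E).offDiag := by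
        ext t; simp [Finset.mem_offDiag]; tauto
      rw [hf, Finset.sum_const, Finset.offDiag_card, hN, nsmul_eq_mul,
        Nat.cast_sub (Nat.le_mul_self Ω)]
      push_cast; ring
    rw [Finset.sum_congr rfl fun v _ => this v, Finset.sum_const, Finset.card_univ, nsmul_eq_mul]
  rw [hcount] at hfin
  have hV : (0 : ℝ) < Fintype.card V := by exact_mod_cast Fintype.card_pos
  have : (Fintype.card V : ℝ) * ((Ω : ℝ) * (Ω - 1) * p ^ 2 * B) ≤
      (Fintype.card V : ℝ) * (2 * γ * M) := by linarith
  exact le_of_mul_le_mul_left this hV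

end MainIneq

section Bounds
variable {V : Type*} [Fintype V] [DecidableEq V]

/-- susceptibility -/
def ch (p : ℝ) (E : Finset (Sym2 V)) (x : V) : ℝ := Ex p E (fun F => ((cl F {x}).card : ℝ))

/-- magnetization -/
def mg (p γ : ℝ) (E : Finset (Sym2 V)) (x : V) : ℝ := Ex p E (fun F => mm γ (cl F {x}))

lemma cl_image_equiv (φ : V ≃ V) (F : Finset (Sym2 V)) (x : V) :
    cl (F.image (Sym2.map φ)) {φ x} = (cl F {x}).image φ := by
  apply Finset.Subset.antisymm
  · apply cl_min
    · simp [self_mem_cl]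
    · intro a b ha hab
      obtain ⟨a', ha', rfl⟩ := Finset.mem_image.1 ha
      obtain ⟨e, he, hee⟩ := Finset.mem_image.1 hab
      have : e = s(a', φ.symm b) := by
        apply Sym2.map.injective φ.injective
        rw [hee]; simp
      subst this
      exact Finset.mem_image.2 ⟨φ.symm b, cl_step ha' he, by simp⟩
  · intro y hy
    obtain ⟨a, ha, rfl⟩ := Finset.mem_image.1 hy
    have : cl F {x} ⊆ (cl (F.image (Sym2.map φ)) {φ x}).image φ.symm := by
      apply cl_min
      · exact Finset.singleton_subset_iff.2
          (Finset.mem_image.2 ⟨φ x, self_mem_cl _ _, by simp⟩)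
      · intro a b ha hab
        obtain ⟨a', ha', rfl⟩ := Finset.mem_image.1 ha
        refine Finset.mem_image.2 ⟨φ b, cl_step ha' ?_, by simp⟩
        exact Finset.mem_image.2 ⟨_, hab, by simp⟩
    obtain ⟨b, hb, hb'⟩ := Finset.mem_image.1 (this ha)
    rw [← hb']; simpa using hb

lemma Ex_card_equiv (p : ℝ) {E : Finset (Sym2 V)} (φ : V ≃ V)
    (hE : E.image (Sym2.map φ) = E) (g : ℕ → ℝ) (x : V) :
    Ex p E (fun F => g (cl F {φ x}).card) = Ex p E (fun F => g (cl F {x}).card) := by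
  conv_lhs => rw [← hE]
  rw [Ex_image p E _ (Sym2.map.injective φ.injective)]
  apply Ex_congr
  intro F _
  rw [cl_image_equiv, Finset.card_image_of_injective _ φ.injective]

lemma ch_step {p χ : ℝ} (hp0 : 0 ≤ p) (hp1 : p ≤ 1) {E : Finset (Sym2 V)} {Ω : ℕ} (v : V)
    (hN : (Finset.univ.filter fun y => s(v, y) ∈ E).card = Ω)
    (hχ : ∀ x, ch p E x = χ) : χ ≤ 1 + p * Ω * χ := by
  have pt : ∀ F, F ⊆ E → ((cl F {v}).card : ℝ) ≤ 1 +
      ∑ y ∈ Finset.univ.filter (fun y => s(v, y) ∈ E),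
        (if s(v, y) ∈ F then ((cl (F.erase s(v, y)) {y}).card : ℝ) else 0) := by
    intro F hF
    set N := Finset.univ.filter (fun y => s(v, y) ∈ E) with hNd
    have hsub : cl F {v} ⊆ {v} ∪
        N.biUnion (fun y => if s(v, y) ∈ F then cl (F.erase s(v, y)) {y} else ∅) := by
      apply cl_min Finset.subset_union_left
      intro a b ha hab
      have hvb : s(v, b) ∈ F →
          b ∈ N.biUnion (fun y => if s(v, y) ∈ F then cl (F.erase s(v, y)) {y} else ∅) := by
        intro h
        refine Finset.mem_biUnion.2 ⟨b, by simp [hNd, hF h], ?_⟩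
        rw [if_pos h]; exact self_mem_cl _ _
      rcases Finset.mem_union.1 ha with ha | ha
      · rw [Finset.mem_singleton] at ha; subst ha
        exact Finset.mem_union_right _ (hvb hab)
      · obtain ⟨y, hy, ha'⟩ := Finset.mem_biUnion.1 ha
        by_cases hvy : s(v, y) ∈ F
        · rw [if_pos hvy] at ha'
          by_cases he : s(a, b) = s(v, y)
          · rcases Sym2.eq_iff.1 he with ⟨rfl, rfl⟩ | ⟨_, rfl⟩
            · exact Finset.mem_union_right _ (hvb hab)
            · exact Finset.mem_union_left _ (Finset.mem_singleton_self _)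
          · refine Finset.mem_union_right _ (Finset.mem_biUnion.2 ⟨y, hy, ?_⟩)
            rw [if_pos hvy]
            exact cl_step ha' (Finset.mem_erase.2 ⟨he, hab⟩)
        · rw [if_neg hvy] at ha'; simp at ha'
    have h1 := (Finset.card_le_card hsub).trans (Finset.card_union_le _ _)
    have h2 := h1.trans (Nat.add_le_add_left Finset.card_biUnion_le _)
    have h3 : ((cl F {v}).card : ℝ) ≤ _ := Nat.cast_le.2 h2
    refine h3.trans (le_of_eq ?_)
    push_cast
    simp only [Finset.card_singleton, Nat.cast_one]
    congr 1
    apply Finset.sum_congr rfl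
    intro y _
    split_ifs <;> simp
  have h := Ex_mono hp0 hp1 E pt
  rw [Ex_add, Ex_const, Ex_sum] at h
  have hv : Ex p E (fun F => ((cl F {v}).card : ℝ)) = χ := hχ v
  rw [hv] at h
  refine h.trans (add_le_add_right ?_ 1)
  have : ∀ y ∈ Finset.univ.filter (fun y => s(v, y) ∈ E),
      Ex p E (fun F => if s(v, y) ∈ F then ((cl (F.erase s(v, y)) {y}).card : ℝ) else 0) ≤
      p * χ := by
    intro y hy
    rw [Finset.mem_filter] at hy
    rw [Ex_mem_erase p hy.2 (fun F => ((cl F {y}).card : ℝ)), ← hχ y]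
    apply mul_le_mul_of_nonneg_left _ hp0
    apply Ex_mono_set hp0 hp1 (Finset.erase_subset _ _)
    intro F F' hFF
    exact_mod_cast Finset.card_le_card (cl_mono hFF (Finset.Subset.refl _))
  refine (Finset.sum_le_sum this).trans (le_of_eq ?_)
  rw [Finset.sum_const, hN, nsmul_eq_mul]; ring

lemma card_mono_cl {F F' : Finset (Sym2 V)} (h : F ⊆ F') (x : V) :
    ((cl F {x}).card : ℝ) ≤ (cl F' {x}).card := by
  exact_mod_cast Finset.card_le_card (cl_mono h (Finset.Subset.refl _))

lemma ch_sum (p : ℝ) (E : Finset (Sym2 V)) (x : V) : ∑ u, tt p E x u = ch p E x := by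
  unfold tt ch
  rw [← Ex_sum]
  apply Ex_congr
  intro F _
  simp

lemma ch_ge_one {p : ℝ} (hp0 : 0 ≤ p) (hp1 : p ≤ 1) (E : Finset (Sym2 V)) (x : V) :
    1 ≤ ch p E x := by
  rw [← Ex_const p E 1]
  apply Ex_mono hp0 hp1
  intro F _
  have : 0 < (cl F {x}).card := Finset.card_pos.2 ⟨x, self_mem_cl _ _⟩
  exact_mod_cast this

lemma second_moment {p χ : ℝ} (hp0 : 0 ≤ p) (hp1 : p ≤ 1) {E : Finset (Sym2 V)}
    (hχ : ∀ x, ch p E x = χ) (v : V) :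
    Ex p E (fun F => ((cl F {v}).card : ℝ) * (cl F {v}).card) ≤ χ ^ 3 := by
  have hm : ∀ C D : Finset V, C ⊆ D → (C.card : ℝ) ≤ D.card := fun C D h => by
    exact_mod_cast Finset.card_le_card h
  have hs : ∀ C D : Finset V, ((C ∪ D).card : ℝ) ≤ C.card + D.card := fun C D => by
    exact_mod_cast Finset.card_union_le C D
  have hP : ∀ E' ⊆ E, ∀ u, Ex p E' (fun F => ((cl F {u}).card : ℝ)) ≤ χ := by
    intro E' hE u
    rw [← hχ u]
    exact Ex_mono_set hp0 hp1 hE fun F F' h => card_mono_cl h u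
  have h := Ex_cov hp0 hp1 (fun C => (C.card : ℝ)) (fun C => (C.card : ℝ)) hm hs hm hs
    (fun _ => χ) (fun _ => χ) E hP hP {v}
  refine h.trans (le_of_eq ?_)
  rw [← Finset.sum_mul]
  have h1 : Ex p E (fun F => ((cl F {v}).card : ℝ)) = χ := hχ v
  have h2 : ∑ u ∈ Finset.univ \ {v}, Ex p E (fun F => if u ∈ cl F {v} then (1:ℝ) else 0) =
      χ - 1 := by
    have h3 := ch_sum p E v
    rw [hχ v, ← Finset.sum_sdiff (Finset.subset_univ ({v} : Finset V)), Finset.sum_singleton,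
      tt_self] at h3
    unfold tt at h3
    linarith
  rw [h1, h2]; ring

lemma pow_upper {γ : ℝ} (h0 : 0 ≤ γ) (h1 : γ ≤ 1) (k : ℕ) :
    (1 - γ) ^ k ≤ 1 - γ * k + γ ^ 2 / 2 * (k * k) := by
  induction k with
  | zero => simp
  | succ k ih =>
    have := mul_le_mul_of_nonneg_left ih (by linarith : 0 ≤ 1 - γ)
    have h3 : 0 ≤ γ ^ 3 * (k : ℝ) ^ 2 := by positivity
    rw [pow_succ]; push_cast
    nlinarith [sq_nonneg γ]

lemma mg_upper_chi {p γ : ℝ} (hp0 : 0 ≤ p) (hp1 : p ≤ 1) (h1 : γ ≤ 1)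
    (E : Finset (Sym2 V)) (x : V) : mg p γ E x ≤ γ * ch p E x := by
  unfold mg ch
  rw [← Ex_mul_left]
  apply Ex_mono hp0 hp1
  intro F _
  unfold mm
  have := one_add_mul_le_pow (by linarith : (-2:ℝ) ≤ -γ) (cl F {x}).card
  rw [← sub_eq_add_neg] at this
  linarith

lemma mg_lower_small {p γ χ : ℝ} (hp0 : 0 ≤ p) (hp1 : p ≤ 1) (h0 : 0 ≤ γ) (h1 : γ ≤ 1)
    {E : Finset (Sym2 V)} (hχ : ∀ x, ch p E x = χ) (hs : γ * χ ^ 2 ≤ 1) (x : V) :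
    γ * χ / 2 ≤ mg p γ E x := by
  have h := Ex_mono hp0 hp1 E (f := fun F => γ * ((cl F {x}).card : ℝ) -
    γ ^ 2 / 2 * (((cl F {x}).card : ℝ) * (cl F {x}).card)) (g := fun F => mm γ (cl F {x}))
    (fun F _ => by
      have := pow_upper h0 h1 (cl F {x}).card
      unfold mm; linarith)
  rw [Ex_sub, Ex_mul_left, Ex_mul_left] at h
  have h2 := second_moment hp0 hp1 hχ x
  have hx : Ex p E (fun F => ((cl F {x}).card : ℝ)) = χ := hχ x
  rw [hx] at h
  refine le_trans ?_ h
  have hχ1 : 1 ≤ χ := by rw [← hχ x]; exact ch_ge_one hp0 hp1 E x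
  have h3 := mul_le_mul_of_nonneg_left h2 (by positivity : 0 ≤ γ ^ 2 / 2)
  have h4 := mul_le_mul_of_nonneg_left hs (by positivity : 0 ≤ γ * χ / 2)
  nlinarith

lemma mg_mono_p {p p' γ : ℝ} (hp0 : 0 ≤ p) (hpp : p ≤ p') (hp1 : p' ≤ 1) (h0 : 0 ≤ γ) (h1 : γ ≤ 1)
    (E : Finset (Sym2 V)) (x : V) : mg p γ E x ≤ mg p' γ E x :=
  Ex_mono_p hp0 hpp hp1 fun _ _ h => mm_mono h0 h1 (cl_mono h (Finset.Subset.refl _))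

lemma mg_lower {p γ : ℝ} (hp0 : 0 ≤ p) (hp1 : p ≤ 1) (h0 : 0 ≤ γ) (h1 : γ ≤ 1)
    {E : Finset (Sym2 V)} (x : V) (hχ : ∀ p, ∀ y, ch p E y = ch p E x) :
    (1 / 3) * min (Real.sqrt γ) (γ * ch p E x) ≤ mg p γ E x := by
  have hχ1 := ch_ge_one hp0 hp1 E x
  by_cases hs : γ * ch p E x ^ 2 ≤ 1
  · have := mg_lower_small hp0 hp1 h0 h1 (hχ p) hs x
    have h2 : 0 ≤ γ * ch p E x := by positivity
    have := min_le_right (Real.sqrt γ) (γ * ch p E x)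
    linarith
  · push Not at hs
    have hγ : 0 < γ := by
      rcases h0.lt_or_eq with h | h
      · exact h
      · rw [← h] at hs; norm_num at hs
    have hsq : 0 < Real.sqrt γ := Real.sqrt_pos.2 hγ
    have hsq2 : Real.sqrt γ ^ 2 = γ := Real.sq_sqrt h0
    have hsq1 : Real.sqrt γ ≤ 1 := Real.sqrt_le_one.2 h1
    have hch0 : ch 0 E x = 1 := by
      have h00 : ch 0 E x = ∑ F ∈ E.powerset,
          (if F = ∅ then ((cl ∅ {x}).card : ℝ) else 0) := by
        unfold ch Ex
        apply Finset.sum_congr rfl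
        intro F _
        by_cases hF : F = ∅
        · subst hF; simp
        · rw [if_neg hF, zero_pow (by simpa using hF)]; ring
      rw [h00, Finset.sum_ite_eq' _ _ _, if_pos (Finset.empty_mem_powerset _)]
      have : cl (∅ : Finset (Sym2 V)) {x} = {x} :=
        Finset.Subset.antisymm (cl_min (Finset.Subset.refl _) (by simp)) (subset_cl _ _)
      rw [this]; simp
    have hcont : ContinuousOn (fun q => ch q E x) (Set.Icc 0 p) :=
      (Ex_continuous E _).continuousOn
    have hmem : (Real.sqrt γ)⁻¹ ∈ Set.Icc (ch 0 E x) (ch p E x) := by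
      rw [hch0]
      refine ⟨(one_le_inv₀ hsq).2 hsq1, ?_⟩
      rw [inv_le_iff_one_le_mul₀ hsq]
      by_contra hc
      push Not at hc
      have : (Real.sqrt γ * ch p E x) ^ 2 < 1 := by
        apply pow_lt_one₀ (by positivity) _ (by norm_num)
        linarith [mul_comm (Real.sqrt γ) (ch p E x)]
      rw [mul_pow, hsq2] at this
      linarith
    obtain ⟨q, hq, hqe⟩ := intermediate_value_Icc hp0 hcont hmem
    have hqe : ch q E x = (Real.sqrt γ)⁻¹ := hqe
    have hg : γ * (Real.sqrt γ)⁻¹ = Real.sqrt γ := by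
      nth_rewrite 1 [← hsq2]; field_simp
    have hs2 : γ * ch q E x ^ 2 ≤ 1 := by
      rw [hqe, inv_pow, hsq2]; exact (mul_inv_cancel₀ hγ.ne').le
    have := mg_lower_small hq.1 (hq.2.trans hp1) h0 h1 (hχ q) hs2 x
    rw [hqe, hg] at this
    have h5 := mg_mono_p hq.1 hq.2 hp1 h0 h1 E x
    have := min_le_left (Real.sqrt γ) (γ * ch p E x)
    linarith

end Bounds

section Upper
variable {V : Type*} [Fintype V] [DecidableEq V]

/-- derivative of the magnetization -/
def dg (p γ : ℝ) (E : Finset (Sym2 V)) (x : V) : ℝ :=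
  Ex p E (fun F => (cl F {x}).card * (1 - γ) ^ ((cl F {x}).card - 1))

lemma mg_deriv (p γ : ℝ) (E : Finset (Sym2 V)) (x : V) :
    HasDerivAt (fun g => mg p g E x) (dg p γ E x) γ := by
  unfold mg dg Ex mm
  apply HasDerivAt.fun_sum
  intro F _
  apply HasDerivAt.const_mul
  have h := (((hasDerivAt_id γ).const_sub 1).pow (cl F {x}).card).const_sub 1
  exact h.congr_deriv (by simp)

lemma dg_eq (p γ : ℝ) (E : Finset (Sym2 V)) (x : V) :
    (1 - γ) * dg p γ E x = Ex p E (fun F => f0 γ (cl F {x})) := by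
  unfold dg
  rw [← Ex_mul_left]
  apply Ex_congr
  intro F _
  have : 0 < (cl F {x}).card := Finset.card_pos.2 ⟨x, self_mem_cl _ _⟩
  obtain ⟨k, hk⟩ := Nat.exists_eq_succ_of_ne_zero this.ne'
  unfold f0
  rw [hk, Nat.succ_sub_one, pow_succ]; ring

lemma mg_nonneg {p γ : ℝ} (hp0 : 0 ≤ p) (hp1 : p ≤ 1) (h0 : 0 ≤ γ) (h1 : γ ≤ 1)
    (E : Finset (Sym2 V)) (x : V) : 0 ≤ mg p γ E x :=
  Ex_nonneg hp0 hp1 _ fun _ _ => mm_nonneg h0 h1 _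

lemma mg_le_one {p γ : ℝ} (hp0 : 0 ≤ p) (hp1 : p ≤ 1) (h1 : γ ≤ 1)
    (E : Finset (Sym2 V)) (x : V) : mg p γ E x ≤ 1 := by
  rw [← Ex_const p E 1]
  apply Ex_mono hp0 hp1
  intro F _
  have := pow_nonneg (by linarith : 0 ≤ 1 - γ) (cl F {x}).card
  unfold mm; linarith

lemma arith_key {K p a M X γ : ℝ} (hK : 997 / 1000 ≤ K) (hp : p ≤ 1 / 1000)
    (ha : a ≤ 1 / 1000) (hγ : 0 < γ) (hM : 0 < M) (hM2 : M ^ 2 = 12 * γ)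
    (h : K * (M ^ 2 * ((1 - a) * (γ * X - 4 * p * M) - 2 * a * M)) ≤ 2 * γ * M) :
    M * X ≤ 3 := by
  by_contra hc
  push Not at hc
  have e : K * (M ^ 2 * ((1 - a) * (γ * X - 4 * p * M) - 2 * a * M)) =
      (γ * M) * (K * ((1 - a) * (M * X - 48 * p) - 24 * a)) := by
    have : γ = M ^ 2 / 12 := by linarith
    rw [this]; ring
  rw [e] at h
  have h2 : K * ((1 - a) * (M * X - 48 * p) - 24 * a) ≤ 2 := by
    have : (γ * M) * (K * ((1 - a) * (M * X - 48 * p) - 24 * a)) ≤ (γ * M) * 2 := by linarith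
    exact le_of_mul_le_mul_left this (by positivity)
  have h3 : (999 / 1000) * (29 / 10) ≤ (1 - a) * (M * X - 48 * p) :=
    mul_le_mul (by linarith) (by linarith) (by norm_num) (by linarith)
  have h4 : (997 / 1000) * (28 / 10) ≤ K * ((1 - a) * (M * X - 48 * p) - 24 * a) :=
    mul_le_mul hK (by linarith) (by norm_num) (by linarith)
  linarith

lemma mg_upper_sqrt {p a χ : ℝ} (hp0 : 0 < p) (hp1 : p ≤ 1)
    {E : Finset (Sym2 V)} (x₀ : V) (ha : a ≤ 1 / 1000)
    (hloop : ∀ v, s(v, v) ∉ E) {Ω : ℕ} (hΩ : 0 < Ω)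
    (hN : ∀ v, (Finset.univ.filter fun y => s(v, y) ∈ E).card = Ω)
    (hinv : ∀ (g : ℕ → ℝ) (x : V), Ex p E (fun F => g (cl F {x}).card) =
      Ex p E (fun F => g (cl F {x₀}).card))
    (hχ : ch p E x₀ = χ) (hχ2 : 1000 ≤ χ)
    (htri : ∀ x y, x ≠ y → ∑ u, ∑ w, tt p E x u * tt p E u w * tt p E w y ≤ a)
    {γ : ℝ} (h0 : 0 ≤ γ) (h1 : γ ≤ 1) :
    mg p γ E x₀ ≤ Real.sqrt (12 * γ) := by
  have : Nonempty V := ⟨x₀⟩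
  apply Real.le_sqrt_of_sq_le
  by_cases hγ : 1 / 12 ≤ γ
  · have h2 := mg_nonneg hp0.le hp1 h0 h1 E x₀
    have h3 := mg_le_one hp0.le hp1 h1 E x₀
    nlinarith
  push Not at hγ
  -- p ≤ a
  have hpa : p ≤ a := by
    obtain ⟨y, hy⟩ : (Finset.univ.filter fun y => s(x₀, y) ∈ E).Nonempty := by
      rw [← Finset.card_pos, hN]; exact hΩ
    have hy : s(x₀, y) ∈ E := (Finset.mem_filter.1 hy).2
    have hne : x₀ ≠ y := by rintro rfl; exact hloop _ hy
    have ht : p ≤ tt p E x₀ y := by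
      have h := Ex_mem_erase p hy (fun _ => 1)
      rw [Ex_const, mul_one] at h
      refine h.symm.le.trans ?_
      apply Ex_mono hp0.le hp1
      intro F _
      by_cases hF : s(x₀, y) ∈ F
      · rw [if_pos hF, if_pos (cl_step (self_mem_cl _ _) hF)]
      · rw [if_neg hF]; positivity
    refine ht.trans (le_trans ?_ (htri x₀ y hne))
    have hnn : ∀ u w, 0 ≤ tt p E x₀ u * tt p E u w * tt p E w y := fun u w =>
      mul_nonneg (mul_nonneg (tt_nonneg hp0.le hp1 _ _ _) (tt_nonneg hp0.le hp1 _ _ _))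
        (tt_nonneg hp0.le hp1 _ _ _)
    calc tt p E x₀ y = tt p E x₀ x₀ * tt p E x₀ x₀ * tt p E x₀ y := by rw [tt_self]; ring
      _ ≤ ∑ w, tt p E x₀ x₀ * tt p E x₀ w * tt p E w y :=
        Finset.single_le_sum (f := fun w => tt p E x₀ x₀ * tt p E x₀ w * tt p E w y)
          (fun w _ => hnn _ _) (Finset.mem_univ x₀)
      _ ≤ _ := Finset.single_le_sum
          (f := fun u => ∑ w, tt p E x₀ u * tt p E u w * tt p E w y)
          (fun u _ => Finset.sum_nonneg fun w _ => hnn _ _) (Finset.mem_univ x₀)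
  have hst := ch_step hp0.le hp1 x₀ (hN x₀) (fun x => (hinv (fun k => (k : ℝ)) x).trans hχ)
  have hpΩ : 999 / 1000 ≤ p * Ω := by
    by_contra hc
    push Not at hc
    nlinarith
  have hK : 997 / 1000 ≤ (Ω : ℝ) * (Ω - 1) * p ^ 2 := by
    have e : (Ω : ℝ) * (Ω - 1) * p ^ 2 = (p * Ω) * (p * Ω - p) := by ring
    rw [e]
    have : (999 / 1000 : ℝ) * (998 / 1000) ≤ (p * Ω) * (p * Ω - p) :=
      mul_le_mul hpΩ (by linarith) (by norm_num) (by linarith)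
    linarith
  have main := image_le_of_deriv_right_lt_deriv_boundary'
    (f := fun g => mg p g E x₀ ^ 2) (f' := fun g => 2 * mg p g E x₀ * dg p g E x₀)
    (a := 0) (b := 1 / 12) (B := fun g => 12 * g) (B' := fun _ => 12)
    (fun g _ => ((mg_deriv p g E x₀).continuousAt.pow 2).continuousWithinAt)
    (fun g _ => by
      have := ((mg_deriv p g E x₀).pow 2).hasDerivWithinAt (s := Set.Ici g)
      exact this.congr_deriv (by simp))
    (by simp [mg, mm, Ex_const]) (by fun_prop)
    (fun g _ => by
      have := ((hasDerivAt_id g).const_mul 12).hasDerivWithinAt (s := Set.Ici g)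
      simpa using this)
    (by
      intro g hg hgM
      have hgM : mg p g E x₀ ^ 2 = 12 * g := hgM
      change 2 * mg p g E x₀ * dg p g E x₀ < 12
      have hg1 : g ≤ 1 := by linarith [hg.2]
      rcases hg.1.eq_or_lt with h | hgp
      · subst h
        have : mg p 0 E x₀ = 0 := by simp [mg, mm, Ex_const]
        rw [this]; norm_num
      · have hMn := mg_nonneg hp0.le hp1 hg.1 hg1 E x₀
        have hMp : 0 < mg p g E x₀ := by
          rcases hMn.eq_or_lt with h | h
          · rw [← h] at hgM; nlinarith
          · exact h
        have hmi := main_ineq hp0.le hp1 hg.1 hg1 (by linarith : a ≤ 1) hloop hN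
          (M := mg p g E x₀) (X := Ex p E (fun F => f0 g (cl F {x₀})))
          (fun x => hinv (fun k => 1 - (1 - g) ^ k) x)
          (fun x => hinv (fun k => k * (1 - g) ^ k) x) htri
        have := arith_key hK (by linarith) ha hgp hMp hgM hmi
        rw [← dg_eq] at this
        have hg2 := hg.2
        nlinarith)
  exact main ⟨h0, hγ.le⟩

end Upper

section Transfer
open Percolation
variable {V : Type*} [Fintype V] [DecidableEq V]

/-- edges of `G` -/
def ed (G : SimpleGraph V) : Finset (Sym2 V) := Finset.univ.filter fun e => e ∈ G.edgeSet

/-- occupied edges -/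
def fs (G : SimpleGraph V) (ω : Config G) : Finset (Sym2 V) :=
  Finset.univ.filter fun e => ∃ h : e ∈ G.edgeSet, ω ⟨e, h⟩ = true

lemma mem_ed {G : SimpleGraph V} {e : Sym2 V} : e ∈ ed G ↔ e ∈ G.edgeSet := by simp [ed]

lemma mem_fs {G : SimpleGraph V} {ω : Config G} {e : Sym2 V} :
    e ∈ fs G ω ↔ ∃ h : e ∈ G.edgeSet, ω ⟨e, h⟩ = true := by simp [fs]

lemma fs_sub (G : SimpleGraph V) (ω : Config G) : fs G ω ⊆ ed G := fun e he => by
  obtain ⟨h, _⟩ := mem_fs.1 he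
  exact mem_ed.2 h

lemma weight_eq (G : SimpleGraph V) (p : ℝ) (ω : Config G) :
    weight G p ω = p ^ (fs G ω).card * (1 - p) ^ (ed G \ fs G ω).card := by
  unfold weight
  have h1 : ∏ e ∈ ed G, (if e ∈ fs G ω then p else 1 - p) =
      ∏ e : G.edgeSet, if (e : Sym2 V) ∈ fs G ω then p else 1 - p :=
    Finset.prod_subtype (ed G) (fun e => mem_ed) _
  have h2 : ∏ e : G.edgeSet, (if ω e then p else 1 - p) =
      ∏ e : G.edgeSet, if (e : Sym2 V) ∈ fs G ω then p else 1 - p := by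
    apply Finset.prod_congr rfl
    rintro ⟨e, he⟩ _
    have : (e ∈ fs G ω) ↔ ω ⟨e, he⟩ = true := by
      rw [mem_fs]; exact ⟨fun ⟨_, h⟩ => h, fun h => ⟨he, h⟩⟩
    simp only [this]
  rw [h2, ← h1, Finset.prod_ite, Finset.prod_const, Finset.prod_const]
  congr 3
  · ext e; simp only [Finset.mem_filter]
    exact ⟨fun h => h.2, fun h => ⟨fs_sub G ω h, h⟩⟩
  · ext e; simp

lemma expect_eq (G : SimpleGraph V) (p : ℝ) (f : Finset (Sym2 V) → ℝ) :
    expect G p (fun ω => f (fs G ω)) = Ex p (ed G) f := by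
  unfold expect Ex
  refine Finset.sum_bij' (fun ω _ => fs G ω)
    (fun F _ => (fun e => decide ((e : Sym2 V) ∈ F) : G.edgeSet → Bool)) ?_ ?_ ?_ ?_ ?_
  · intro ω _; exact Finset.mem_powerset.2 (fs_sub G ω)
  · intro F _; exact Finset.mem_univ _
  · intro ω _
    funext e
    obtain ⟨e, he⟩ := e
    have : (e ∈ fs G ω) ↔ ω ⟨e, he⟩ = true := by
      rw [mem_fs]; exact ⟨fun ⟨_, h⟩ => h, fun h => ⟨he, h⟩⟩
    simp only [this]
    simp
  · intro F hF
    ext e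
    refine mem_fs.trans ?_
    constructor
    · rintro ⟨_, h⟩; simpa using h
    · intro h; exact ⟨mem_ed.1 (Finset.mem_powerset.1 hF h), by simpa using h⟩
  · intro ω _
    rw [weight_eq]

lemma prob_expect (G : SimpleGraph V) (p : ℝ) (A : Config G → Prop) :
    prob G p A = expect G p (fun ω => if A ω then 1 else 0) := by
  unfold prob expect
  apply Finset.sum_congr rfl
  intro ω _
  by_cases h : A ω <;> simp [h]

lemma reach_iff (G : SimpleGraph V) (ω : Config G) (x y : V) :
    (occupied G ω).Reachable x y ↔ y ∈ cl (fs G ω) {x} := by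
  rw [SimpleGraph.reachable_iff_reflTransGen]
  have hadj : ∀ a b, (occupied G ω).Adj a b ↔ s(a, b) ∈ fs G ω := by
    intro a b
    unfold occupied
    rw [SimpleGraph.fromEdgeSet_adj, mem_fs]
    constructor
    · exact fun h => h.1
    · intro h
      refine ⟨h, ?_⟩
      obtain ⟨h, _⟩ := h
      exact G.ne_of_adj h
  simp only [cl, Finset.mem_filter, Finset.mem_univ, true_and, Finset.mem_singleton,
    exists_eq_left]
  have : (occupied G ω).Adj = fun a b => s(a, b) ∈ fs G ω := by
    funext a b; exact propext (hadj a b)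
  rw [this]

lemma cluster_eq (G : SimpleGraph V) (ω : Config G) (x : V) :
    cluster G ω x = cl (fs G ω) {x} := by
  ext y
  unfold cluster
  rw [Finset.mem_filter, reach_iff]; simp

lemma chi_eq (G : SimpleGraph V) (x : V) (p : ℝ) : chi G x p = ch p (ed G) x := by
  unfold chi ch
  rw [← expect_eq]
  simp only [cluster_eq]

lemma tau_eq (G : SimpleGraph V) (p : ℝ) (x y : V) : tau G p x y = tt p (ed G) x y := by
  unfold tau tt
  rw [prob_expect, ← expect_eq]
  simp only [reach_iff]

lemma mag_eq (G : SimpleGraph V) (x : V) (p γ : ℝ) :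
    magnetization G x p γ = mg p γ (ed G) x := by
  unfold magnetization mg
  have : ∀ k, prob G p (fun ω => (cluster G ω x).card = k) =
      Ex p (ed G) (fun F => if (cl F {x}).card = k then 1 else 0) := by
    intro k
    rw [prob_expect, ← expect_eq]
    simp only [cluster_eq]
  simp only [this, ← Ex_mul_left]
  rw [← Ex_sum]
  apply Ex_congr
  intro F _
  unfold mm
  simp only [mul_ite, mul_one, mul_zero]
  rw [Finset.sum_ite_eq, if_pos]
  rw [Finset.mem_Icc]
  exact ⟨Finset.card_pos.2 ⟨x, self_mem_cl _ _⟩, Finset.card_le_univ _⟩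

lemma ed_image (G : SimpleGraph V) (φ : G ≃g G) :
    (ed G).image (Sym2.map φ.toEquiv) = ed G := by
  ext e
  induction e using Sym2.ind with
  | _ a b =>
  rw [Finset.mem_image, mem_ed, SimpleGraph.mem_edgeSet]
  constructor
  · rintro ⟨e, he, hee⟩
    induction e using Sym2.ind with
    | _ c d =>
    rw [mem_ed, SimpleGraph.mem_edgeSet] at he
    have : s(a, b) ∈ G.edgeSet := by
      rw [← hee]; exact φ.map_rel_iff.2 he
    exact this
  · intro h
    refine ⟨s(φ.symm a, φ.symm b), mem_ed.2 (φ.symm.map_rel_iff.2 h), ?_⟩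
    rw [Sym2.map_mk]
    exact congrArg₂ _ (φ.apply_symm_apply a) (φ.apply_symm_apply b)

lemma inv_of_trans {G : SimpleGraph V} (hT : IsTransitive G) (p : ℝ) (x₀ : V) (g : ℕ → ℝ) (x : V) :
    Ex p (ed G) (fun F => g (cl F {x}).card) = Ex p (ed G) (fun F => g (cl F {x₀}).card) := by
  obtain ⟨φ, rfl⟩ := hT x₀ x
  exact Ex_card_equiv p φ.toEquiv (ed_image G φ) g x₀

lemma ed_deg {G : SimpleGraph V} [DecidableRel G.Adj] {Ω : ℕ} (h : G.IsRegularOfDegree Ω) (v : V) :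
    (Finset.univ.filter fun y => s(v, y) ∈ ed G).card = Ω := by
  rw [← h v, ← SimpleGraph.card_neighborFinset_eq_degree]
  congr 1
  ext y
  simp [mem_ed]

end Transfer
end PercAux

open Percolation in
/-- Theorem 1.7(i) (The magnetization): two-sided bounds on the magnetization
for `p ≤ p_c`. -/
theorem magnetization_subcritical_bounds :
    ∃ b₀ : ℝ, 0 < b₀ ∧
      ∀ (V : Type) [Fintype V] [DecidableEq V]
        (G : SimpleGraph V) [DecidableRel G.Adj],
        G.Connected → IsTransitive G →
        ∀ Ω : ℕ, G.IsRegularOfDegree Ω →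
        ∀ (x₀ : V) (lam : ℝ), 0 < lam →
        1 < lam * (Fintype.card V : ℝ) ^ ((1 : ℝ) / 3) →
        lam * (Fintype.card V : ℝ) ^ ((1 : ℝ) / 3) < (Fintype.card V : ℝ) →
        b₀⁻¹ ≤ lam * (Fintype.card V : ℝ) ^ ((1 : ℝ) / 3) →
        ∀ pc : ℝ, 0 < pc → pc < 1 →
        chi G x₀ pc = lam * (Fintype.card V : ℝ) ^ ((1 : ℝ) / 3) →
        ∀ a₀ : ℝ, a₀ ≤ b₀ →
        (∀ x y : V, triangle G pc x y ≤ kron x y + a₀) →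
        ∀ p : ℝ, 0 ≤ p → p ≤ pc →
        ∀ γ : ℝ, 0 ≤ γ → γ ≤ 1 →
          (1 / 3) * min (Real.sqrt γ) (γ * chi G x₀ p) ≤ magnetization G x₀ p γ ∧
            magnetization G x₀ p γ ≤ min (Real.sqrt (12 * γ)) (γ * chi G x₀ p) := by
  refine ⟨1 / 1000, by norm_num, ?_⟩
  intro V _ _ G _ hconn hT Ω hreg x₀ lam _ hl1 hlV hlb pc hpc0 hpc1 hchi a₀ ha₀ htri p hp0 hpp γ h0 h1
  have hp1 : p ≤ 1 := hpp.trans hpc1.le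
  rw [PercAux.mag_eq, PercAux.chi_eq]
  refine ⟨PercAux.mg_lower hp0 hp1 h0 h1 x₀
    (fun q y => PercAux.inv_of_trans hT q x₀ (fun k => (k : ℝ)) y),
    le_min ?_ (PercAux.mg_upper_chi hp0 hp1 h1 _ _)⟩
  refine (PercAux.mg_mono_p hp0 hpp hpc1.le h0 h1 _ _).trans ?_
  have hΩ : 0 < Ω := by
    have hV : (1 : ℝ) < Fintype.card V := hl1.trans hlV
    have hV : 1 < Fintype.card V := by exact_mod_cast hV
    have : Nontrivial V := Fintype.one_lt_card_iff_nontrivial.1 hV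
    rw [← hreg x₀]
    exact hconn.preconnected.degree_pos_of_nontrivial x₀
  rw [PercAux.chi_eq] at hchi
  refine PercAux.mg_upper_sqrt hpc0 hpc1.le x₀ ha₀ ?_ hΩ (PercAux.ed_deg hreg)
    (fun g x => PercAux.inv_of_trans hT pc x₀ g x) hchi ?_ ?_ h0 h1
  · intro v hv
    exact G.ne_of_adj (PercAux.mem_ed.1 hv) rfl
  · norm_num at hlb; linarith
  · intro x y hxy
    have := htri x y
    simp only [triangle, kron, if_neg hxy, PercAux.tau_eq, zero_add] at this
    exact this
end
end

section
/- Let 𝔾 = K_n be the complete graph on n ≥ 2 vertices (so V = n and every vertex has degree Ω = n − 1). Then for every p ∈ [0,1] and all vertices x, y, the triangle diagram satisfies ∇_p(x,y) ≤ δ_{x,y} + 7·χ(p)³/n. -/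
noncomputable section
open Classical

namespace Percolation

section helpers
variable {V : Type*} [Fintype V] [DecidableEq V]

lemma weight_nonneg' (G : SimpleGraph V) {p : ℝ} (hp0 : 0 ≤ p) (hp1 : p ≤ 1) (ω : Config G) :
    0 ≤ weight G p ω := by
  unfold weight
  refine Finset.prod_nonneg fun e _ => ?_
  split_ifs <;> linarith

lemma weight_sum' (G : SimpleGraph V) (p : ℝ) : ∑ ω : Config G, weight G p ω = 1 := by
  unfold weight
  have h := Finset.prod_univ_sum (ι := G.edgeSet) (fun _ => (Finset.univ : Finset Bool))
    (fun _ b => if b then p else 1 - p)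
  rw [Fintype.piFinset_univ] at h
  have h2 : ∏ e : G.edgeSet, ∑ b : Bool, (if b then p else 1 - p) = 1 := by
    simp
  rw [h2] at h
  exact h.symm

lemma tau_self' (G : SimpleGraph V) (p : ℝ) (x : V) : tau G p x x = 1 := by
  unfold tau prob
  simp only [SimpleGraph.Reachable.refl, if_true]
  exact weight_sum' G p

lemma tau_nonneg' (G : SimpleGraph V) {p : ℝ} (hp0 : 0 ≤ p) (hp1 : p ≤ 1) (x y : V) :
    0 ≤ tau G p x y := by
  unfold tau prob
  refine Finset.sum_nonneg fun ω _ => ?_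
  split_ifs
  · exact weight_nonneg' G hp0 hp1 ω
  · exact le_rfl

lemma tau_le_one' (G : SimpleGraph V) {p : ℝ} (hp0 : 0 ≤ p) (hp1 : p ≤ 1) (x y : V) :
    tau G p x y ≤ 1 := by
  rw [← weight_sum' G p]
  unfold tau prob
  refine Finset.sum_le_sum fun ω _ => ?_
  split_ifs
  · exact le_rfl
  · exact weight_nonneg' G hp0 hp1 ω

lemma chi_eq' (G : SimpleGraph V) (p : ℝ) (x : V) : chi G x p = ∑ y, tau G p x y := by
  unfold chi expect tau prob cluster
  rw [Finset.sum_comm]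
  refine Finset.sum_congr rfl fun ω _ => ?_
  beta_reduce
  rw [Finset.card_filter, Nat.cast_sum, Finset.mul_sum]
  refine Finset.sum_congr rfl fun z _ => ?_
  by_cases h : (occupied G ω).Reachable x z <;> simp [h]

lemma occupied_adj' (G : SimpleGraph V) (ω : Config G) (a b : V) :
    (occupied G ω).Adj a b ↔ ∃ h : G.Adj a b, ω ⟨s(a, b), h⟩ = true := by
  unfold occupied
  rw [SimpleGraph.fromEdgeSet_adj]
  constructor
  · rintro ⟨⟨h, h'⟩, _⟩
    exact ⟨h, h'⟩
  · rintro ⟨h, h'⟩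
    exact ⟨⟨h, h'⟩, h.ne⟩

lemma tau_iso' (G : SimpleGraph V) (p : ℝ) (φ : G ≃g G) (x y : V) :
    tau G p (φ x) (φ y) = tau G p x y := by
  unfold tau prob
  let E : Config G ≃ Config G := Equiv.arrowCongr φ.mapEdgeSet.symm (Equiv.refl Bool)
  refine Fintype.sum_equiv E _ _ fun ω => ?_
  have hE : ∀ e, E ω e = ω (φ.mapEdgeSet e) := fun e => rfl
  have hw : weight G p (E ω) = weight G p ω := by
    unfold weight
    simp only [hE]
    exact Fintype.prod_equiv φ.mapEdgeSet _ _ fun e => rfl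
  let ψ : occupied G (E ω) ≃g occupied G ω :=
    { toEquiv := φ.toEquiv
      map_rel_iff' := by
        intro a b
        rw [occupied_adj', occupied_adj']
        constructor
        · rintro ⟨h, h'⟩
          exact ⟨φ.map_rel_iff.1 h, h'⟩
        · rintro ⟨h, h'⟩
          exact ⟨φ.map_rel_iff.2 h, h'⟩ }
  have hr : (occupied G ω).Reachable (φ x) (φ y) ↔ (occupied G (E ω)).Reachable x y :=
    ψ.reachable_iff
  simp only [hr, hw]

lemma tau_top' (p : ℝ) {a b x y : V} (hab : a ≠ b) (hxy : x ≠ y) :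
    tau (⊤ : SimpleGraph V) p x y = tau (⊤ : SimpleGraph V) p a b := by
  obtain ⟨σ, hx, hy⟩ : ∃ σ : Equiv.Perm V, σ a = x ∧ σ b = y := by
    refine ⟨(Equiv.swap a x).trans (Equiv.swap (Equiv.swap a x b) y), ?_, ?_⟩
    · have h1 : x ≠ Equiv.swap a x b := by
        intro h
        apply hab
        apply (Equiv.swap a x).injective
        rw [← h, Equiv.swap_apply_left]
      simp [Equiv.swap_apply_of_ne_of_ne h1 hxy]
    · simp
  have h := tau_iso' (⊤ : SimpleGraph V) p (SimpleGraph.Iso.completeGraph σ) a b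
  rw [← h, ← hx, ← hy]
  rfl

end helpers

end Percolation
open Percolation in
/-- Section 2.1.1: the triangle condition for the complete graph `K_n`. -/
theorem complete_graph_triangle_condition
    (n : ℕ) (hn : 2 ≤ n)
    (p : ℝ) (hp0 : 0 ≤ p) (hp1 : p ≤ 1)
    (x₀ x y : Fin n) :
    triangle (⊤ : SimpleGraph (Fin n)) p x y ≤
      kron x y + 7 * chi (⊤ : SimpleGraph (Fin n)) x₀ p ^ 3 / (n : ℝ) := by
  have hab : (⟨0, by omega⟩ : Fin n) ≠ ⟨1, by omega⟩ := by simp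
  obtain ⟨t, ht⟩ : ∃ t, t = tau (⊤ : SimpleGraph (Fin n)) p ⟨0, by omega⟩ ⟨1, by omega⟩ := ⟨_, rfl⟩
  have ht0 : 0 ≤ t := ht ▸ tau_nonneg' _ hp0 hp1 _ _
  have ht1 : t ≤ 1 := ht ▸ tau_le_one' _ hp0 hp1 _ _
  have htau : ∀ u v : Fin n, tau (⊤ : SimpleGraph (Fin n)) p u v
      = t + (1 - t) * (if u = v then 1 else 0) := by
    intro u v
    split_ifs with h
    · subst h; rw [tau_self']; ring
    · rw [tau_top' p hab h, ← ht]; ring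
  have hn0 : (0 : ℝ) < n := by exact_mod_cast (by omega : 0 < n)
  have hrow : ∀ u : Fin n, ∑ v, (t + (1 - t) * (if u = v then (1 : ℝ) else 0)) = n * t + (1 - t) := by
    intro u
    simp [Finset.sum_add_distrib]
  have hchi : chi (⊤ : SimpleGraph (Fin n)) x₀ p = n * t + (1 - t) := by
    rw [chi_eq']
    simp only [htau]
    exact hrow x₀
  have htri : triangle (⊤ : SimpleGraph (Fin n)) p x y
      = (1 - t) ^ 3 * (if x = y then 1 else 0)
        + (3 * (1 - t) ^ 2 * t + 3 * (1 - t) * t ^ 2 * n + t ^ 3 * n ^ 2) := by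
    unfold triangle
    simp only [htau]
    simp only [mul_add, add_mul, Finset.sum_add_distrib, mul_ite, ite_mul, mul_one, mul_zero,
      zero_mul, Finset.sum_ite_eq, Finset.sum_ite_eq', Finset.mem_univ, if_true, Finset.sum_const,
      Finset.card_univ, Fintype.card_fin, nsmul_eq_mul]
    split_ifs <;> ring
  rw [htri, hchi]
  have h3 : 3 * (1 - t) ^ 2 * t + 3 * (1 - t) * t ^ 2 * n + t ^ 3 * n ^ 2
      ≤ 7 * (n * t + (1 - t)) ^ 3 / n := by
    rw [le_div_iff₀ hn0]
    have h1 : 0 ≤ (1 - t) ^ 3 := pow_nonneg (by linarith) 3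
    have h2 : 0 ≤ (n * t + (1 - t)) ^ 3 :=
      pow_nonneg (add_nonneg (mul_nonneg hn0.le ht0) (by linarith)) 3
    have h4 : (3 * (1 - t) ^ 2 * t + 3 * (1 - t) * t ^ 2 * n + t ^ 3 * n ^ 2) * n
      = (n * t + (1 - t)) ^ 3 - (1 - t) ^ 3 := by ring
    linarith
  have h5 : (1 - t) ^ 3 * (if x = y then (1 : ℝ) else 0) ≤ kron x y := by
    unfold kron
    have : (1 - t) ^ 3 ≤ 1 := pow_le_one₀ (by linarith) (by linarith)
    split_ifs <;> linarith
  linarith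
end
end
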